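/- arXiv:1311.4748 — 2 statements merged into one kernel-verified Lean document; each statement's English description precedes it below -/
import Mathlib

section
/- For all integers N and d with N ≥ d ≥ 1, the set 𝓖_{N,d}^ℂ of N×N complex matrices P satisfying P^* = P, P² = P, rank P = d, and P_{nn} = d/N for every n ∈ {1, …, N}, is path-connected (as a subset of the space of N×N complex matrices with its standard topology). -/
noncomputable section

/-- The set `𝓖_{N,d}^ℂ` of rank-`d` complex orthogonal projections on `ℂ^N` all of whose
diagonal entries equal `d/N`. -/
def ProjSet (N d : ℕ) : Set (Matrix (Fin N) (Fin N) ℂ) :=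
  {P | P.conjTranspose = P ∧ P * P = P ∧ P.rank = d ∧ ∀ n, P n n = (d : ℂ) / (N : ℂ)}

open Matrix

/-- entrywise differentiability of a matrix curve -/
def MD {m n : Type*} (M : ℝ → Matrix m n ℂ) (M' : Matrix m n ℂ) (t : ℝ) : Prop :=
  ∀ i j, HasDerivAt (fun s => M s i j) (M' i j) t

lemma MD.mul {l m n : Type*} [Fintype m] {A : ℝ → Matrix l m ℂ} {B : ℝ → Matrix m n ℂ} {A' B'} {t}
    (hA : MD A A' t) (hB : MD B B' t) : MD (fun s => A s * B s) (A' * B t + A t * B') t := by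
  intro i j
  simp only [Matrix.mul_apply, Matrix.add_apply, ← Finset.sum_add_distrib]
  exact HasDerivAt.fun_sum fun k _ => (hA i k).mul (hB k j)

lemma MD.conj {m n : Type*} {A : ℝ → Matrix m n ℂ} {A'} {t}
    (hA : MD A A' t) : MD (fun s => (A s)ᴴ) (A'ᴴ) t := by
  intro i j
  simp only [Matrix.conjTranspose_apply]
  exact (hA j i).star

lemma MD.const {m n : Type*} (A : Matrix m n ℂ) (t) : MD (fun _ => A) 0 t := by
  intro i j
  simpa using hasDerivAt_const t (A i j)

lemma MD.trace {m : Type*} [Fintype m] {A : ℝ → Matrix m m ℂ} {A'} {t}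
    (hA : MD A A' t) : HasDerivAt (fun s => (A s).trace) A'.trace t := by
  simp only [Matrix.trace, Matrix.diag]
  exact HasDerivAt.fun_sum fun k _ => hA k k

lemma continuousAt_inv' {m : Type*} [Fintype m] [DecidableEq m] {X : Type*} [TopologicalSpace X]
    {M : X → Matrix m m ℂ} {t : X} (hM : ContinuousAt M t) (h : (M t).det ≠ 0) :
    ContinuousAt (fun s => (M s)⁻¹) t := by
  have h1 : ContinuousAt (fun s => (M s).det) t :=
    (Continuous.matrix_det continuous_id).continuousAt.comp hM
  have h2 : ContinuousAt (fun s => (M s).adjugate) t :=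
    (Continuous.matrix_adjugate continuous_id).continuousAt.comp hM
  simp only [Matrix.inv_def, Ring.inverse_eq_inv']
  exact (h1.inv₀ h).smul h2

lemma MD.continuousAt {m n : Type*} {M : ℝ → Matrix m n ℂ} {M'} {t}
    (hM : MD M M' t) : ContinuousAt M t := by
  refine tendsto_pi_nhds.2 fun i => tendsto_pi_nhds.2 fun j => (hM i j).continuousAt

lemma MD_iff {m n : Type*} {M : ℝ → Matrix m n ℂ} {M'} {t} :
    MD M M' t ↔ Filter.Tendsto (fun s => (s - t)⁻¹ • (M s - M t)) (nhdsWithin t {t}ᶜ) (nhds M') := by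
  constructor
  · intro h
    refine tendsto_pi_nhds.2 fun i => tendsto_pi_nhds.2 fun j => ?_
    exact hasDerivAt_iff_tendsto_slope.1 (h i j)
  · intro h i j
    exact hasDerivAt_iff_tendsto_slope.2 (tendsto_pi_nhds.1 (tendsto_pi_nhds.1 h i) j)

lemma MD.inv {m : Type*} [Fintype m] [DecidableEq m] {M : ℝ → Matrix m m ℂ} {M'} {t}
    (hM : MD M M' t) (h : (M t).det ≠ 0) : MD (fun s => (M s)⁻¹) (-((M t)⁻¹ * M' * (M t)⁻¹)) t := by
  have hc := continuousAt_inv' hM.continuousAt h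
  have hdet : ∀ᶠ s in nhds t, (M s).det ≠ 0 :=
    ((Continuous.matrix_det continuous_id).continuousAt.comp hM.continuousAt).eventually_ne h
  rw [MD_iff] at hM ⊢
  have hc' : Filter.Tendsto (fun s => (M s)⁻¹) (nhdsWithin t {t}ᶜ) (nhds ((M t)⁻¹)) :=
    hc.tendsto.mono_left nhdsWithin_le_nhds
  have h3 : Filter.Tendsto (fun s => -((M s)⁻¹ * ((s - t)⁻¹ • (M s - M t)) * (M t)⁻¹))
      (nhdsWithin t {t}ᶜ) (nhds (-((M t)⁻¹ * M' * (M t)⁻¹))) :=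
    ((hc'.mul hM).mul tendsto_const_nhds).neg
  refine h3.congr' ?_
  filter_upwards [hdet.filter_mono nhdsWithin_le_nhds] with s hs
  have e1 := Matrix.nonsing_inv_mul (M s) (isUnit_iff_ne_zero.2 hs)
  have e2 := Matrix.mul_nonsing_inv (M t) (isUnit_iff_ne_zero.2 h)
  rw [Matrix.mul_smul, Matrix.smul_mul, ← smul_neg, Matrix.mul_sub, Matrix.sub_mul, e1,
    Matrix.mul_assoc _ (M t), e2]
  simp

/-- projection on the row space -/
def Pr {N d : ℕ} (A : Matrix (Fin d) (Fin N) ℂ) : Matrix (Fin N) (Fin N) ℂ := Aᴴ * (A * Aᴴ)⁻¹ * A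

def sc {N d : ℕ} (A : Matrix (Fin d) (Fin N) ℂ) (x : Fin N → ℝ) : Matrix (Fin d) (Fin N) ℂ :=
  A * diagonal (fun i => ((Real.exp (x i / 2) : ℝ) : ℂ))

section
variable {N d : ℕ} {A : Matrix (Fin d) (Fin N) ℂ}

lemma Pr_conj (A : Matrix (Fin d) (Fin N) ℂ) : (Pr A)ᴴ = Pr A := by
  simp [Pr, Matrix.conjTranspose_nonsing_inv, Matrix.mul_assoc]

lemma Pr_idem (h : (A * Aᴴ).det ≠ 0) : Pr A * Pr A = Pr A := by
  have := Matrix.nonsing_inv_mul (A * Aᴴ) (isUnit_iff_ne_zero.2 h)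
  calc Pr A * Pr A = Aᴴ * ((A * Aᴴ)⁻¹ * (A * Aᴴ)) * (A * Aᴴ)⁻¹ * A := by
        simp only [Pr, Matrix.mul_assoc]
    _ = Pr A := by rw [this]; simp [Pr]

lemma Pr_trace (h : (A * Aᴴ).det ≠ 0) : (Pr A).trace = d := by
  rw [Pr, Matrix.trace_mul_comm, ← Matrix.mul_assoc, Matrix.mul_nonsing_inv _ (isUnit_iff_ne_zero.2 h)]
  simp

lemma Pr_mul_self (h : (A * Aᴴ).det ≠ 0) : A * Pr A = A := by
  rw [Pr, ← Matrix.mul_assoc, ← Matrix.mul_assoc, Matrix.mul_nonsing_inv _ (isUnit_iff_ne_zero.2 h)]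
  simp

lemma Pr_rank (h : (A * Aᴴ).det ≠ 0) : (Pr A).rank = d := by
  apply le_antisymm
  · exact (Matrix.rank_mul_le_right _ _).trans ((Matrix.rank_le_height A))
  · have h1 : (A * Aᴴ).rank = d := by
      rw [Matrix.rank_of_isUnit _ ((Matrix.isUnit_iff_isUnit_det _).2 (isUnit_iff_ne_zero.2 h))]; simp
    have h2 : A.rank ≤ (Pr A).rank := by
      conv_lhs => rw [← Pr_mul_self h]
      exact Matrix.rank_mul_le_right _ _
    have h3 := Matrix.rank_mul_le_left A Aᴴ
    omega

lemma sc_zero (A : Matrix (Fin d) (Fin N) ℂ) : sc A 0 = A := by simp [sc]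

lemma sc_add (A : Matrix (Fin d) (Fin N) ℂ) (x y) : sc (sc A x) y = sc A (x + y) := by
  simp only [sc, Matrix.mul_assoc, Matrix.diagonal_mul_diagonal]
  congr 2; ext i
  rw [← Complex.ofReal_mul, ← Real.exp_add]; simp [add_div]

lemma det_ne_of_rank {M : Matrix (Fin d) (Fin d) ℂ} (h : M.rank = d) : M.det ≠ 0 := by
  have h1 : Function.Surjective M.mulVecLin := by
    rw [← LinearMap.range_eq_top]
    apply Submodule.eq_top_of_finrank_eq
    rw [← Matrix.rank, h]; simp
  have h2 : IsUnit M := Matrix.mulVec_surjective_iff_isUnit.1 h1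
  exact isUnit_iff_ne_zero.1 ((Matrix.isUnit_iff_isUnit_det _).1 h2)

open scoped ComplexOrder in
lemma det_ne_of_rank' (h : d ≤ A.rank) : (A * Aᴴ).det ≠ 0 := by
  have h3 : (A * Aᴴ).rank = A.rank := Matrix.rank_self_mul_conjTranspose A
  exact det_ne_of_rank (le_antisymm (Matrix.rank_le_height _) (by omega))

lemma sc_det (h : (A * Aᴴ).det ≠ 0) (x) : (sc A x * (sc A x)ᴴ).det ≠ 0 := by
  apply det_ne_of_rank'
  have h1 : (A * Aᴴ).rank = d := by
    rw [Matrix.rank_of_isUnit _ ((Matrix.isUnit_iff_isUnit_det _).2 (isUnit_iff_ne_zero.2 h))]; simp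
  have h3 := Matrix.rank_mul_le_left A Aᴴ
  have h4 : A = sc A x * diagonal (fun i => ((Real.exp (-x i / 2) : ℝ) : ℂ)) := by
    have := sc_add A x (-x)
    rw [add_neg_cancel, sc_zero] at this
    conv_lhs => rw [← this]
    simp [sc]
  have h5 : A.rank ≤ (sc A x).rank := by
    conv_lhs => rw [h4]
    exact Matrix.rank_mul_le_left _ _
  omega

lemma det_ne_of_minor {f : Fin d → Fin N} (h : (A.submatrix id f).det ≠ 0) : (A * Aᴴ).det ≠ 0 := by
  have h1 : (A.submatrix id f).rank = d := by
    rw [Matrix.rank_of_isUnit _ ((Matrix.isUnit_iff_isUnit_det _).2 (isUnit_iff_ne_zero.2 h))]; simp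
  have h2 : (A.submatrix id f).rank ≤ A.rank := by
    have : A.submatrix id f = A * (1 : Matrix (Fin N) (Fin N) ℂ).submatrix id f := by
      ext i j; simp [Matrix.mul_apply, Matrix.one_apply]
    rw [this]; exact Matrix.rank_mul_le_left _ _
  exact det_ne_of_rank' (by omega)

/-- Frobenius norm squared -/
def fro (M : Matrix (Fin N) (Fin N) ℂ) : ℝ := ∑ i, ∑ j, ‖M i j‖ ^ 2

lemma fro_eq (M : Matrix (Fin N) (Fin N) ℂ) (h : Mᴴ = M) : (M * M).trace.re = fro M := by
  simp only [fro, Matrix.trace, Matrix.diag, Matrix.mul_apply, Complex.re_sum]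
  refine Finset.sum_congr rfl fun i _ => Finset.sum_congr rfl fun j _ => ?_
  have : M j i = star (M i j) := by
    conv_lhs => rw [← h]
    rfl
  rw [this, Complex.star_def, Complex.mul_conj, Complex.ofReal_re, Complex.normSq_eq_norm_sq]

lemma sc_MD (A : Matrix (Fin d) (Fin N) ℂ) (x : Fin N → ℝ) (t : ℝ) :
    MD (fun s => sc A (s • x)) ((1/2 : ℂ) • (sc A (t • x) * diagonal (fun i => (x i : ℂ)))) t := by
  intro i j
  simp only [sc, Matrix.mul_diagonal, Matrix.smul_apply, Pi.smul_apply, smul_eq_mul]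
  have h1 : HasDerivAt (fun s : ℝ => Real.exp (s * x j / 2)) (Real.exp (t * x j / 2) * (x j / 2)) t := by
    apply HasDerivAt.exp
    simpa using ((hasDerivAt_id t).mul_const (x j)).div_const 2
  have h2 := (h1.ofReal_comp).const_mul (A i j)
  have e : 1 / 2 * (A i j * ((Real.exp (t * x j / 2) : ℝ) : ℂ) * (x j : ℂ))
      = A i j * ((Real.exp (t * x j / 2) * (x j / 2) : ℝ) : ℂ) := by
    rw [Complex.ofReal_mul, Complex.ofReal_div]; push_cast; ring
  rw [e]; exact h2

lemma Pr_MD (h : (A * Aᴴ).det ≠ 0) (x : Fin N → ℝ) (t : ℝ) (Q X : Matrix (Fin N) (Fin N) ℂ)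
    (hQ : Q = Pr (sc A (t • x))) (hX : X = diagonal (fun i => (x i : ℂ))) :
    MD (fun s => Pr (sc A (s • x))) ((1/2 : ℂ) • (X * Q + Q * X) - Q * X * Q) t := by
  have hS := sc_MD A x t
  have hd := sc_det h (t • x)
  have := (hS.conj.mul ((hS.mul hS.conj).inv hd)).mul hS
  simp only [Pr]
  convert this using 1
  have hXX : Xᴴ = X := by
    rw [hX, Matrix.diagonal_conjTranspose]; congr 1; ext i; simp
  rw [← hX, Matrix.conjTranspose_smul, Matrix.conjTranspose_mul, hXX, hQ, Pr]
  generalize sc A (t • x) = S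
  generalize (S * Sᴴ)⁻¹ = W
  have e : star (1/2 : ℂ) = 1/2 := by simp
  rw [e]
  simp only [Matrix.mul_add, Matrix.add_mul, Matrix.smul_mul, Matrix.mul_smul, Matrix.mul_assoc, smul_add, Matrix.neg_mul, Matrix.mul_neg, neg_add]
  module

lemma key (h : (A * Aᴴ).det ≠ 0) (x : Fin N → ℝ) :
    fro (Pr (sc A x) - Pr A) ≤ 1 / 2 * ∑ i, x i * ((Pr (sc A x) i i).re - (Pr A i i).re) := by
  set Δ := Pr (sc A x) - Pr A with hΔ
  have hΔh : Δᴴ = Δ := by rw [hΔ, Matrix.conjTranspose_sub, Pr_conj, Pr_conj]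
  set X : Matrix (Fin N) (Fin N) ℂ := diagonal (fun i => (x i : ℂ)) with hX
  have hXX : Xᴴ = X := by
    rw [hX, Matrix.diagonal_conjTranspose]; congr 1; ext i; simp
  let k : ℝ → ℝ := fun s => 1/4 * (X * Pr (sc A (s • x))).trace.re - (Δ * Pr (sc A (s • x))).trace.re
    + s / 2 * fro Δ
  have hk : ∀ t, ∃ k', HasDerivAt k k' t ∧ 0 ≤ k' := by
    intro t
    set Q := Pr (sc A (t • x)) with hQ
    have hQQ : Q * Q = Q := Pr_idem (sc_det h _)
    have hQh : Qᴴ = Q := Pr_conj _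
    have h1 := Pr_MD h x t Q X hQ hX
    set Q' := ((1/2 : ℂ) • (X * Q + Q * X) - Q * X * Q) with hQ'
    have hQ'h : Q'ᴴ = Q' := by
      simp [hQ', Matrix.conjTranspose_sub, Matrix.conjTranspose_smul, hQh, hXX, Matrix.mul_assoc, add_comm]
    have d1 := ((MD.const X t).mul h1).trace
    have d2 := ((MD.const Δ t).mul h1).trace
    simp only [Matrix.zero_mul, zero_add] at d1 d2
    have re1 : ∀ {f : ℝ → ℂ} {f'}, HasDerivAt f f' t → HasDerivAt (fun s => (f s).re) f'.re t := by
      intro f f' hf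
      exact (Complex.reCLM.hasFDerivAt.comp_hasDerivAt t hf)
    refine ⟨1/4 * (X * Q').trace.re - (Δ * Q').trace.re + 1 / 2 * fro Δ, ?_, ?_⟩
    · exact (((re1 d1).const_mul (1/4)).sub (re1 d2)).add (((hasDerivAt_id t).div_const 2).mul_const _)
    · have e1 : (Q' * Q').trace = 1/2 * (X * Q').trace := by
        have c1 : (X * Q * (X * Q)).trace = (Q * X * (Q * X)).trace := by
          rw [← Matrix.mul_assoc, Matrix.trace_mul_comm]; simp only [Matrix.mul_assoc]
        have c2 : (X * Q * (Q * X)).trace = (X * X * Q).trace := by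
          rw [Matrix.mul_assoc, ← Matrix.mul_assoc Q, hQQ, ← Matrix.mul_assoc, Matrix.trace_mul_comm, ← Matrix.mul_assoc]
        have c3 : (Q * X * (X * Q)).trace = (X * X * Q).trace := by
          rw [Matrix.trace_mul_comm, c2]
        have c4 : (X * Q * (Q * X * Q)).trace = (X * Q * (X * Q)).trace := by
          rw [show X * Q * (Q * X * Q) = X * (Q * Q) * (X * Q) by simp only [Matrix.mul_assoc], hQQ]
        have c5 : (Q * X * (Q * X * Q)).trace = (X * Q * (X * Q)).trace := by
          rw [Matrix.trace_mul_comm, c1,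
            show Q * X * Q * (Q * X) = Q * X * (Q * Q) * X by simp only [Matrix.mul_assoc], hQQ]
          simp only [Matrix.mul_assoc]
        have c6 : (Q * X * Q * (Q * X * Q)).trace = (X * Q * (X * Q)).trace := by
          rw [show Q * X * Q * (Q * X * Q) = Q * (X * (Q * Q) * (X * Q)) by simp only [Matrix.mul_assoc], hQQ,
            Matrix.trace_mul_comm, show X * Q * (X * Q) * Q = X * Q * (X * (Q * Q)) by simp only [Matrix.mul_assoc], hQQ]
        have c7 : (Q * X * Q * (X * Q)).trace = (X * Q * (X * Q)).trace := by
          rw [Matrix.trace_mul_comm, show X * Q * (Q * X * Q) = X * (Q * Q) * (X * Q) by simp only [Matrix.mul_assoc], hQQ]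
        have c8 : (Q * X * Q * (Q * X)).trace = (X * Q * (X * Q)).trace := by
          rw [Matrix.trace_mul_comm, c5]
        have c9 : (X * (X * Q)).trace = (X * X * Q).trace := by rw [Matrix.mul_assoc]
        have c10 : (X * (Q * X)).trace = (X * X * Q).trace := by
          rw [Matrix.trace_mul_comm, Matrix.mul_assoc, Matrix.trace_mul_comm]
        have c11 : (X * (Q * X * Q)).trace = (X * Q * (X * Q)).trace := by
          simp only [Matrix.mul_assoc]
        rw [hQ']
        simp only [Matrix.mul_add, Matrix.add_mul, Matrix.mul_sub, Matrix.sub_mul, Matrix.smul_mul, Matrix.mul_smul,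
          Matrix.trace_add, Matrix.trace_sub, Matrix.trace_smul, smul_eq_mul, smul_add]
        rw [c2, c3, c4, c5, c6, c7, c8, c9, c10, c11, ← c1]
        ring
      have e2 := fro_eq (Q' - Δ) (by rw [Matrix.conjTranspose_sub, hQ'h, hΔh])
      have e3 : 0 ≤ fro (Q' - Δ) := by unfold fro; positivity
      have e4 := fro_eq Δ hΔh
      have e5 : ((Q' - Δ) * (Q' - Δ)).trace = (Q' * Q').trace - 2 * (Δ * Q').trace + (Δ * Δ).trace := by
        clear_value Q' Δ
        rw [Matrix.mul_sub, Matrix.sub_mul, Matrix.sub_mul]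
        simp only [Matrix.trace_sub]
        rw [Matrix.trace_mul_comm Q' Δ]; ring
      rw [e5, e1] at e2
      have e6 : (1/2 * (X * Q').trace - 2 * (Δ * Q').trace + (Δ * Δ).trace).re =
          1/2 * (X * Q').trace.re - 2 * (Δ * Q').trace.re + (Δ * Δ).trace.re := by
        simp
      rw [e6, e4] at e2
      linarith
  have hmono : Monotone k := by
    apply monotone_of_deriv_nonneg
    · intro t; obtain ⟨k', h1, _⟩ := hk t; exact h1.differentiableAt
    · intro t; obtain ⟨k', h1, h2⟩ := hk t; rw [h1.deriv]; exact h2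
  have h01 := hmono zero_le_one
  simp only [k, one_smul, zero_smul, sc_zero] at h01
  have e4 := fro_eq Δ hΔh
  have e5 : (Δ * Δ).trace.re = (Δ * Pr (sc A x)).trace.re - (Δ * Pr A).trace.re := by
    conv_lhs => rw [hΔ, Matrix.mul_sub, ← hΔ]
    simp
  have e6 : ∑ i, x i * ((Pr (sc A x) i i).re - (Pr A i i).re) =
      (X * Pr (sc A x)).trace.re - (X * Pr A).trace.re := by
    simp [hX, Matrix.trace, Matrix.diagonal_mul, mul_sub]
  rw [e6]
  linarith
end

section
variable {N d : ℕ} {A : Matrix (Fin d) (Fin N) ℂ}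
open scoped Nat

lemma cb_aux (A : Matrix (Fin d) (Fin N) ℂ) (B : Matrix (Fin N) (Fin d) ℂ) :
    (A * B).det = ∑ f : Fin d → Fin N, (∏ i, B (f i) i) * (A.submatrix id f).det := by
  simp only [Matrix.det_apply', Matrix.mul_apply, Finset.prod_univ_sum, Finset.mul_sum,
    Fintype.piFinset_univ, Matrix.submatrix_apply, id, Finset.prod_mul_distrib]
  rw [Finset.sum_comm]
  refine Finset.sum_congr rfl fun f _ => Finset.sum_congr rfl fun σ _ => ?_
  ring

lemma cb (A : Matrix (Fin d) (Fin N) ℂ) :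
    (d ! : ℂ) * (A * Aᴴ).det = ((∑ f : Fin d → Fin N, ‖(A.submatrix id f).det‖ ^ 2 : ℝ) : ℂ) := by
  have h1 : ∀ τ : Equiv.Perm (Fin d), (A * Aᴴ).det =
      ∑ f : Fin d → Fin N, (((Equiv.Perm.sign τ : ℤ) : ℂ) * ∏ i, Aᴴ (f (τ i)) i) * (A.submatrix id f).det := by
    intro τ
    rw [cb_aux, ← (Equiv.arrowCongr τ.symm (Equiv.refl (Fin N))).sum_comp]
    refine Finset.sum_congr rfl fun f _ => ?_
    have : A.submatrix id ((Equiv.arrowCongr τ.symm (Equiv.refl (Fin N))) f) = (A.submatrix id f).submatrix id τ := by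
      ext i j; simp
    rw [this, Matrix.det_permute']
    simp; ring
  have h2 : (d ! : ℂ) * (A * Aᴴ).det = ∑ τ : Equiv.Perm (Fin d), (A * Aᴴ).det := by
    simp [Fintype.card_perm]
  rw [h2, Finset.sum_congr rfl fun τ _ => h1 τ, Finset.sum_comm]
  push_cast
  refine Finset.sum_congr rfl fun f _ => ?_
  rw [← Finset.sum_mul]
  have h3 : ∑ τ : Equiv.Perm (Fin d), (((Equiv.Perm.sign τ : ℤ) : ℂ) * ∏ i, Aᴴ (f (τ i)) i)
      = star (A.submatrix id f).det := by
    rw [← Matrix.det_conjTranspose, Matrix.det_apply']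
    rfl
  rw [h3, mul_comm, Complex.star_def, Complex.mul_conj, Complex.normSq_eq_norm_sq]
  push_cast; rfl

def G (A : Matrix (Fin d) (Fin N) ℂ) : ℝ := (A * Aᴴ).det.re

lemma G_eq (A : Matrix (Fin d) (Fin N) ℂ) : (d ! : ℝ) * G A = ∑ f : Fin d → Fin N, ‖(A.submatrix id f).det‖ ^ 2 := by
  have := congrArg Complex.re (cb A)
  rw [Complex.ofReal_re] at this
  rw [← this, G]
  simp

lemma det_eq_G (A : Matrix (Fin d) (Fin N) ℂ) : (A * Aᴴ).det = (G A : ℂ) := by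
  have h := cb A
  rw [← G_eq] at h
  push_cast at h
  exact mul_left_cancel₀ (by exact_mod_cast Nat.factorial_ne_zero d) h

lemma G_ge (A : Matrix (Fin d) (Fin N) ℂ) (f) : ‖(A.submatrix id f).det‖ ^ 2 ≤ (d ! : ℝ) * G A := by
  rw [G_eq]
  exact Finset.single_le_sum (f := fun f => ‖(A.submatrix id f).det‖ ^ 2) (fun _ _ => by positivity) (Finset.mem_univ f)

lemma sc_minor (A : Matrix (Fin d) (Fin N) ℂ) (x) (f : Fin d → Fin N) :
    ‖((sc A x).submatrix id f).det‖ ^ 2 = ‖(A.submatrix id f).det‖ ^ 2 * Real.exp (∑ j, x (f j)) := by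
  have : (sc A x).submatrix id f = A.submatrix id f * diagonal (fun j => ((Real.exp (x (f j) / 2) : ℝ) : ℂ)) := by
    ext i j; simp [sc, Matrix.mul_diagonal]
  rw [this, Matrix.det_mul, Matrix.det_diagonal, norm_mul, mul_pow, norm_prod]
  congr 1
  rw [Real.exp_sum, ← Finset.prod_pow]
  refine Finset.prod_congr rfl fun j _ => ?_
  rw [Complex.norm_real, Real.norm_of_nonneg (Real.exp_pos _).le, ← Real.exp_nat_mul]
  congr 1; push_cast; ring

lemma G_pos (h : (A * Aᴴ).det ≠ 0) : 0 < G A := by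
  have h1 : 0 ≤ (d ! : ℝ) * G A := by rw [G_eq]; positivity
  have h2 : (0:ℝ) < d ! := by exact_mod_cast Nat.factorial_pos d
  have h3 : G A ≠ 0 := by
    intro h0; rw [det_eq_G, h0] at h; simp at h
  exact lt_of_le_of_ne (nonneg_of_mul_nonneg_right h1 h2) h3.symm

lemma det_scale (h : (A * Aᴴ).det ≠ 0) (δ : Fin N → ℂ) :
    (A * diagonal (fun i => 1 + δ i) * Aᴴ).det = (A * Aᴴ).det * (1 + diagonal δ * Pr A).det := by
  have e : A * diagonal (fun i => 1 + δ i) * Aᴴ = (A * Aᴴ) * (1 + ((A * Aᴴ)⁻¹ * A) * (diagonal δ * Aᴴ)) := by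
    have : diagonal (fun i => 1 + δ i) = 1 + diagonal δ := by
      rw [← Matrix.diagonal_one, Matrix.diagonal_add]
    have h1 := Matrix.mul_nonsing_inv (A * Aᴴ) (isUnit_iff_ne_zero.2 h)
    rw [this, Matrix.mul_add, Matrix.mul_add, Matrix.add_mul,
      show A * Aᴴ * ((A * Aᴴ)⁻¹ * A * (diagonal δ * Aᴴ)) = (A * Aᴴ * (A * Aᴴ)⁻¹) * (A * (diagonal δ * Aᴴ)) by
        simp only [Matrix.mul_assoc], h1]
    simp [Matrix.mul_assoc]
  rw [e, Matrix.det_mul, Matrix.det_one_add_mul_comm]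
  simp only [Pr, Matrix.mul_assoc]

lemma det_two_aux (P : Matrix (Fin N) (Fin N) ℂ) (e : Fin 2 → Fin N) (hij : e 0 ≠ e 1) (v : Fin 2 → ℂ) :
    (1 + diagonal (fun k => if k = e 0 then v 0 else if k = e 1 then v 1 else 0) * P).det
      = (1 + v 0 * P (e 0) (e 0)) * (1 + v 1 * P (e 1) (e 1)) - v 0 * v 1 * (P (e 0) (e 1) * P (e 1) (e 0)) := by
  let E : Matrix (Fin N) (Fin 2) ℂ := (1 : Matrix (Fin N) (Fin N) ℂ).submatrix id e
  have h1 : diagonal (fun k => if k = e 0 then v 0 else if k = e 1 then v 1 else 0) * P =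
      E * (diagonal v * P.submatrix e id) := by
    ext k l
    rw [Matrix.diagonal_mul, Matrix.mul_apply, Fin.sum_univ_two, Matrix.diagonal_mul, Matrix.diagonal_mul]
    simp only [E, Matrix.submatrix_apply, Matrix.one_apply, id]
    by_cases hk : k = e 0
    · subst hk; simp [hij]
    · by_cases hk' : k = e 1
      · subst hk'; simp [hk]
      · simp [hk, hk']
  have h2 : diagonal v * P.submatrix e id * E = diagonal v * P.submatrix e e := by
    rw [Matrix.mul_assoc]; congr 1
    ext a b; simp [E, Matrix.mul_apply, Matrix.one_apply]
  rw [h1, Matrix.det_one_add_mul_comm, h2, Matrix.det_fin_two]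
  simp only [Matrix.add_apply, Matrix.diagonal_mul, Matrix.submatrix_apply, Matrix.one_apply]
  simp
  ring

lemma det_two (P : Matrix (Fin N) (Fin N) ℂ) (i j : Fin N) (hij : i ≠ j) (α β : ℂ) :
    (1 + diagonal (fun k => if k = i then α else if k = j then β else 0) * P).det
      = (1 + α * P i i) * (1 + β * P j j) - α * β * (P i j * P j i) :=
  det_two_aux P ![i, j] hij ![α, β]

lemma Pr_diag_re (A : Matrix (Fin d) (Fin N) ℂ) (i) : ((Pr A i i).re : ℂ) = Pr A i i := by
  have := congrFun (congrFun (Pr_conj A) i) i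
  rw [Matrix.conjTranspose_apply] at this
  exact Complex.conj_eq_iff_re.1 this

lemma crit (h : (A * Aᴴ).det ≠ 0) (hmin : ∀ y : Fin N → ℝ, ∑ i, y i = 0 → G A ≤ G (sc A y))
    (i j : Fin N) (hij : i ≠ j) : (Pr A i i).re = (Pr A j j).re := by
  set p := (Pr A i i).re with hp
  set q := (Pr A j j).re with hq
  have hr : ∃ r : ℝ, Pr A i j * Pr A j i = r := by
    have := congrFun (congrFun (Pr_conj A) j) i
    rw [Matrix.conjTranspose_apply] at this
    exact ⟨_, by rw [← this, Complex.star_def, Complex.mul_conj]⟩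
  obtain ⟨r, hr⟩ := hr
  have main : ∀ α : ℝ, -1 < α → 0 ≤ α * (p - q) + α ^ 2 * (p - (p * q - r)) := by
    intro α hα
    have hα' : 0 < 1 + α := by linarith
    set β : ℝ := (1 + α)⁻¹ - 1 with hβ
    let y : Fin N → ℝ := fun k => if k = i then Real.log (1 + α) else if k = j then -Real.log (1 + α) else 0
    have hy : ∑ k, y k = 0 := by
      have : ∀ k, y k = (if k = i then Real.log (1 + α) else 0) + (if k = j then -Real.log (1 + α) else 0) := by
        intro k; simp only [y]
        by_cases hk : k = i
        · subst hk; simp [hij]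
        · simp [hk]
      simp [this, Finset.sum_add_distrib]
    have h1 := hmin y hy
    have h2 : sc A y * (sc A y)ᴴ = A * diagonal (fun k => 1 + (if k = i then (α : ℂ) else if k = j then (β : ℂ) else 0)) * Aᴴ := by
      have e : ∀ k, Real.exp (y k / 2) * Real.exp (y k / 2) = 1 + (if k = i then α else if k = j then β else 0) := by
        intro k
        rw [← Real.exp_add, add_halves]
        simp only [y]
        split_ifs
        · rw [Real.exp_log hα']
        · rw [Real.exp_neg, Real.exp_log hα', hβ]; ring
        · simp
      rw [sc, Matrix.conjTranspose_mul, Matrix.mul_assoc, ← Matrix.mul_assoc (diagonal _), Matrix.diagonal_conjTranspose,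
        Matrix.diagonal_mul_diagonal, ← Matrix.mul_assoc]
      congr 3; ext k
      have e' := congrArg (fun z : ℝ => (z : ℂ)) (e k)
      simp only [Complex.ofReal_mul, Complex.ofReal_add] at e'
      simp only [Pi.star_apply, Complex.star_def, Complex.conj_ofReal]
      rw [e']
      split_ifs <;> simp
    have h3 : G (sc A y) = G A * ((1 + α * p) * (1 + β * q) - α * β * r) := by
      have : (G (sc A y) : ℂ) = ((G A * ((1 + α * p) * (1 + β * q) - α * β * r) : ℝ) : ℂ) := by
        rw [← det_eq_G, h2, det_scale h, det_two _ _ _ hij, hr, det_eq_G, ← Pr_diag_re, ← Pr_diag_re A j]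
        push_cast; rfl
      exact_mod_cast this
    have hG := G_pos h
    have h4 : 1 ≤ (1 + α * p) * (1 + β * q) - α * β * r := by
      rw [h3] at h1
      by_contra hc; push Not at hc
      nlinarith
    have h5 : β * (1 + α) = -α := by rw [hβ]; field_simp; ring
    have h6 : 0 ≤ ((1 + α * p) * (1 + β * q) - α * β * r - 1) * (1 + α) := mul_nonneg (by linarith) hα'.le
    have h7 : ((1 + α * p) * (1 + β * q) - α * β * r - 1) * (1 + α) = α * p * (1 + α) + (β * (1 + α)) * (q + α * p * q - α * r) := by ring
    rw [h7, h5] at h6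
    linarith
  by_contra hne
  set c := p - (p * q - r)
  set b := p - q with hb
  have hb0 : b ≠ 0 := fun h0 => hne (by linarith)
  -- choose α = - b / M
  have hM : 0 < |c| + |b| + 1 := by positivity
  have h1 := main (-b / (|c| + |b| + 1)) (by
    rw [lt_div_iff₀ hM]; have := le_abs_self b; have := abs_nonneg c; linarith)
  have h2 : -b / (|c| + |b| + 1) * b + (-b / (|c| + |b| + 1)) ^ 2 * c = (b^2 / (|c| + |b| + 1)^2) * (c - (|c| + |b| + 1)) := by
    field_simp; ring
  rw [h2] at h1
  have h3 : 0 < b^2 / (|c| + |b| + 1)^2 := by positivity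
  have h4 : c - (|c| + |b| + 1) < 0 := by have := le_abs_self c; have := abs_nonneg b; linarith
  nlinarith

lemma comb (hd : 1 ≤ d) (hN : d < N) (x : Fin N → ℝ) (hx : ∑ i, x i = 0) :
    ∃ f : Fin d → Fin N, Function.Injective f ∧ 0 ≤ ∑ j, x (f j) ∧ ∀ i, |x i| ≤ N * ∑ j, x (f j) := by
  classical
  have hne : (Finset.powersetCard d (Finset.univ : Finset (Fin N))).Nonempty := by
    rw [Finset.powersetCard_nonempty]; simp; omega
  obtain ⟨I, hI, hmax⟩ := Finset.exists_max_image _ (fun I => ∑ i ∈ I, x i) hne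
  rw [Finset.mem_powersetCard_univ] at hI
  set S := ∑ i ∈ I, x i with hS
  have hsum : ∑ j ∈ Iᶜ, x j = -S := by
    have := Finset.sum_add_sum_compl I x
    linarith
  have hle : ∀ i ∈ I, ∀ j ∈ Iᶜ, 0 ≤ x i - x j := by
    intro i hi j hj
    rw [Finset.mem_compl] at hj
    have hj' : j ∉ I.erase i := fun h => hj (Finset.mem_of_mem_erase h)
    have := hmax (insert j (I.erase i)) (by
      rw [Finset.mem_powersetCard_univ, Finset.card_insert_of_notMem hj', Finset.card_erase_of_mem hi]; omega)
    rw [Finset.sum_insert hj'] at this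
    have h2 := Finset.add_sum_erase I x hi
    linarith
  have hcI : (Iᶜ).card = N - d := by rw [Finset.card_compl, hI]; simp
  have htot : ∑ i ∈ I, ∑ j ∈ Iᶜ, (x i - x j) = N * S := by
    simp only [Finset.sum_sub_distrib, Finset.sum_const, hsum, hcI, hI, nsmul_eq_mul, ← Finset.mul_sum]
    rw [← hS, Nat.cast_sub hN.le]; ring
  have hpair : ∀ i ∈ I, ∀ j ∈ Iᶜ, x i - x j ≤ N * S := by
    intro i hi j hj
    rw [← htot]
    calc x i - x j ≤ ∑ j ∈ Iᶜ, (x i - x j) := Finset.single_le_sum (f := fun j => x i - x j) (fun j hj => hle i hi j hj) hj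
      _ ≤ _ := Finset.single_le_sum (f := fun i => ∑ j ∈ Iᶜ, (x i - x j)) (fun i hi => Finset.sum_nonneg (fun j hj => hle i hi j hj)) hi
  obtain ⟨i0, hi0⟩ : I.Nonempty := by rw [← Finset.card_pos]; omega
  obtain ⟨j0, hj0⟩ : (Iᶜ).Nonempty := by rw [← Finset.card_pos]; omega
  have hNS : 0 ≤ N * S := (hle i0 hi0 j0 hj0).trans (hpair i0 hi0 j0 hj0)
  have hN0 : (0:ℝ) < N := by exact_mod_cast (by omega : 0 < N)
  have hS0 : 0 ≤ S := nonneg_of_mul_nonneg_right hNS hN0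
  have hall : ∀ k l, x k - x l ≤ N * S := by
    intro k l
    by_cases hk : k ∈ I <;> by_cases hl : l ∈ I
    · have := hpair k hk j0 hj0; have := hle l hl j0 hj0; linarith
    · exact hpair k hk l (by simpa using hl)
    · have := hle l hl k (by simpa using hk); linarith
    · have := hpair i0 hi0 l (by simpa using hl); have := hle i0 hi0 k (by simpa using hk); linarith
  have hex1 : ∃ k, x k ≤ 0 := by
    by_contra hc; push Not at hc
    have := Finset.sum_pos (fun i _ => hc i) (⟨i0, Finset.mem_univ _⟩ : (Finset.univ : Finset (Fin N)).Nonempty)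
    linarith
  have hex2 : ∃ k, 0 ≤ x k := by
    by_contra hc; push Not at hc
    have := Finset.sum_neg (fun i _ => hc i) (⟨i0, Finset.mem_univ _⟩ : (Finset.univ : Finset (Fin N)).Nonempty)
    linarith
  obtain ⟨k1, hk1⟩ := hex1
  obtain ⟨k2, hk2⟩ := hex2
  have hfS : ∑ j, x (I.orderEmbOfFin hI j) = S := by
    rw [hS, ← Finset.sum_coe_sort I, ← (I.orderIsoOfFin hI).toEquiv.sum_comp]
    rfl
  refine ⟨I.orderEmbOfFin hI, (I.orderEmbOfFin hI).injective, by rw [hfS]; exact hS0, fun i => ?_⟩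
  rw [hfS, abs_le]
  have := hall i k1; have := hall k2 i
  constructor <;> linarith
end

section
variable {N d : ℕ} {A : Matrix (Fin d) (Fin N) ℂ}
open scoped Nat Topology
open Filter

/-- all maximal minors nonzero -/
def Gen (A : Matrix (Fin d) (Fin N) ℂ) : Prop :=
  ∀ f : Fin d → Fin N, Function.Injective f → (A.submatrix id f).det ≠ 0

open Classical in
def Lb (A : Matrix (Fin d) (Fin N) ℂ) : ℝ :=
  N * (|Real.log ((d ! : ℝ) * G A)| + ∑ f : Fin d → Fin N with Function.Injective f,
    |Real.log (‖(A.submatrix id f).det‖ ^ 2)|)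

lemma Lb_nonneg (A : Matrix (Fin d) (Fin N) ℂ) : 0 ≤ Lb A := by unfold Lb; positivity

lemma Gen.det (hN : d ≤ N) (h : Gen A) : (A * Aᴴ).det ≠ 0 :=
  det_ne_of_minor (h (Fin.castLE hN) (Fin.castLE_injective hN))

lemma Lb_bound (hd : 1 ≤ d) (hN : d < N) (h : Gen A) (x : Fin N → ℝ) (hx : ∑ i, x i = 0)
    (hG : G (sc A x) ≤ G A) (i) : |x i| ≤ Lb A := by
  classical
  obtain ⟨f, hf, hS, hb⟩ := comb hd hN x hx
  refine (hb i).trans ?_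
  unfold Lb
  apply mul_le_mul_of_nonneg_left _ (Nat.cast_nonneg N)
  have h1 := G_ge (sc A x) f
  rw [sc_minor] at h1
  have hw : 0 < ‖(A.submatrix id f).det‖ ^ 2 := by have := h f hf; positivity
  have hfac : (0:ℝ) < d ! := by exact_mod_cast Nat.factorial_pos d
  have h2 : ‖(A.submatrix id f).det‖ ^ 2 * Real.exp (∑ j, x (f j)) ≤ (d ! : ℝ) * G A :=
    h1.trans (mul_le_mul_of_nonneg_left hG hfac.le)
  have h3 := Real.log_le_log (by positivity) h2
  rw [Real.log_mul hw.ne' (Real.exp_pos _).ne', Real.log_exp] at h3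
  have h4 : |Real.log (‖(A.submatrix id f).det‖ ^ 2)| ≤ ∑ f : Fin d → Fin N with Function.Injective f,
    |Real.log (‖(A.submatrix id f).det‖ ^ 2)| :=
    Finset.single_le_sum (f := fun f : Fin d → Fin N => |Real.log (‖(A.submatrix id f).det‖ ^ 2)|)
      (fun _ _ => abs_nonneg _) (by simpa using hf)
  have := le_abs_self (Real.log ((d ! : ℝ) * G A))
  have := neg_abs_le (Real.log (‖(A.submatrix id f).det‖ ^ 2))
  linarith

lemma G_sc_cont (A : Matrix (Fin d) (Fin N) ℂ) : Continuous (fun x : Fin N → ℝ => G (sc A x)) := by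
  have h1 : Continuous (fun x : Fin N → ℝ => sc A x) := by
    unfold sc
    refine continuous_const.matrix_mul (Continuous.matrix_diagonal ?_)
    fun_prop
  unfold G
  exact Complex.continuous_re.comp (h1.matrix_mul h1.matrix_conjTranspose).matrix_det

lemma exist_x (hd : 1 ≤ d) (hN : d < N) (h : Gen A) :
    ∃ x : Fin N → ℝ, ∑ i, x i = 0 ∧ (∀ i, |x i| ≤ Lb A) ∧ ∀ i, Pr (sc A x) i i = (d : ℂ) / N := by
  have hdet := h.det hN.le
  let K : Set (Fin N → ℝ) := {x | ∑ i, x i = 0} ∩ Set.Icc (fun _ => -Lb A) (fun _ => Lb A)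
  have hK : IsCompact K := by
    apply isCompact_Icc.inter_left
    exact isClosed_eq (by fun_prop) continuous_const
  have hL := Lb_nonneg A
  have h0 : (0 : Fin N → ℝ) ∈ K := ⟨by simp, fun i => by simpa using hL, fun i => by simpa using hL⟩
  obtain ⟨x, hxK, hmin⟩ := hK.exists_isMinOn ⟨0, h0⟩ (G_sc_cont A).continuousOn
  have hx0 : G (sc A x) ≤ G A := by simpa [sc_zero] using hmin h0
  have hglob : ∀ y : Fin N → ℝ, ∑ i, y i = 0 → G (sc A x) ≤ G (sc A y) := by
    intro y hy
    by_cases hc : G (sc A y) ≤ G A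
    · have hb := Lb_bound hd hN h y hy hc
      exact hmin ⟨hy, fun i => (abs_le.1 (hb i)).1, fun i => (abs_le.1 (hb i)).2⟩
    · linarith
  refine ⟨x, hxK.1, Lb_bound hd hN h x hxK.1 hx0, ?_⟩
  have hdx := sc_det hdet x
  have hc : ∀ i j, Pr (sc A x) i i = Pr (sc A x) j j := by
    intro i j
    by_cases hij : i = j
    · rw [hij]
    have := crit hdx (fun y hy => by
      rw [sc_add]; apply hglob
      have hx1 : ∑ i, x i = 0 := hxK.1
      simp [Finset.sum_add_distrib, hy, hx1]) i j hij
    rw [← Pr_diag_re, this, Pr_diag_re]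
  intro i
  have ht := Pr_trace hdx
  rw [Matrix.trace, Finset.sum_congr rfl (fun j _ => show (Pr (sc A x)).diag j = Pr (sc A x) i i from hc j i)] at ht
  simp at ht
  rw [← ht]
  have : (N : ℂ) ≠ 0 := by exact_mod_cast (by omega : N ≠ 0)
  field_simp

open Classical in
def Xc (A : Matrix (Fin d) (Fin N) ℂ) : Fin N → ℝ :=
  if h : ∃ x : Fin N → ℝ, ∑ i, x i = 0 ∧ (∀ i, |x i| ≤ Lb A) ∧ ∀ i, Pr (sc A x) i i = (d : ℂ) / N
  then h.choose else 0

lemma Xc_spec (hd : 1 ≤ d) (hN : d < N) (h : Gen A) :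
    ∑ i, Xc A i = 0 ∧ (∀ i, |Xc A i| ≤ Lb A) ∧ ∀ i, Pr (sc A (Xc A)) i i = (d : ℂ) / N := by
  have := exist_x hd hN h
  rw [Xc, dif_pos this]
  exact this.choose_spec

def Qc (A : Matrix (Fin d) (Fin N) ℂ) : Matrix (Fin N) (Fin N) ℂ := Pr (sc A (Xc A))

lemma Qc_mem (hd : 1 ≤ d) (hN : d < N) (h : Gen A) : Qc A ∈ ProjSet N d := by
  have hdet := sc_det (h.det hN.le) (Xc A)
  exact ⟨Pr_conj _, Pr_idem hdet, Pr_rank hdet, (Xc_spec hd hN h).2.2⟩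

/-- main estimate -/
lemma est (hd : 1 ≤ d) (hN : d < N) (h : Gen A) (x : Fin N → ℝ) :
    fro (Qc A - Pr (sc A x)) ≤ 1 / 2 * ∑ i, (Lb A + |x i|) * |(Pr (sc A x) i i).re - (d : ℝ) / N| := by
  have hs := Xc_spec hd hN h
  have hk := key (sc_det (h.det hN.le) x) (Xc A - x)
  rw [sc_add, add_sub_cancel] at hk
  refine hk.trans ?_
  apply mul_le_mul_of_nonneg_left _ (by norm_num)
  apply Finset.sum_le_sum
  intro i _
  rw [hs.2.2 i]
  have e : ((d : ℂ) / N).re = (d : ℝ) / N := by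
    rw [← Complex.ofReal_natCast, ← Complex.ofReal_natCast, ← Complex.ofReal_div, Complex.ofReal_re]
  rw [e]
  refine (le_abs_self _).trans ?_
  rw [abs_mul, abs_sub_comm ((d : ℝ) / N)]
  apply mul_le_mul_of_nonneg_right _ (abs_nonneg _)
  exact (abs_sub _ _).trans (add_le_add (hs.2.1 i) le_rfl)

lemma tendsto_of_fro {ι : Type*} {l : Filter ι} {F H : ι → Matrix (Fin N) (Fin N) ℂ} {P}
    (h : Tendsto (fun t => fro (F t - H t)) l (𝓝 0)) (hH : Tendsto H l (𝓝 P)) : Tendsto F l (𝓝 P) := by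
  have h1 : Tendsto (fun t => F t - H t) l (𝓝 0) := by
    refine tendsto_pi_nhds.2 fun i => tendsto_pi_nhds.2 fun j => ?_
    have h2 : Tendsto (fun t => ‖(F t - H t) i j‖ ^ 2) l (𝓝 0) := by
      refine squeeze_zero (fun _ => by positivity) (fun t => ?_) h
      unfold fro
      calc ‖(F t - H t) i j‖ ^ 2 ≤ ∑ j, ‖(F t - H t) i j‖ ^ 2 :=
            Finset.single_le_sum (f := fun j => ‖(F t - H t) i j‖ ^ 2) (fun _ _ => by positivity) (Finset.mem_univ j)
        _ ≤ _ := Finset.single_le_sum (f := fun i => ∑ j, ‖(F t - H t) i j‖ ^ 2) (fun _ _ => by positivity) (Finset.mem_univ i)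
    have h3 := h2.sqrt
    simp only [Real.sqrt_sq (norm_nonneg _), Real.sqrt_zero] at h3
    exact tendsto_zero_iff_norm_tendsto_zero.2 h3
  have := h1.add hH
  simpa using this

lemma Pr_cont {X : Type*} [TopologicalSpace X] {F : X → Matrix (Fin d) (Fin N) ℂ} {t : X}
    (hF : ContinuousAt F t) (h : (F t * (F t)ᴴ).det ≠ 0) : ContinuousAt (fun s => Pr (F s)) t := by
  have hFc : ContinuousAt (fun s => (F s)ᴴ) t := (continuous_id.matrix_conjTranspose).continuousAt.comp hF
  have hmul : ∀ {a b c : ℕ} {U : X → Matrix (Fin a) (Fin b) ℂ} {V : X → Matrix (Fin b) (Fin c) ℂ},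
      ContinuousAt U t → ContinuousAt V t → ContinuousAt (fun s => U s * V s) t := by
    intro a b c U V hU hV
    exact (Continuous.matrix_mul continuous_fst continuous_snd).continuousAt.comp (hU.prodMk hV)
  exact hmul (hmul hFc (continuousAt_inv' (hmul hF hFc) h)) hF

lemma G_cont : Continuous (fun A : Matrix (Fin d) (Fin N) ℂ => G A) := by
  unfold G
  exact Complex.continuous_re.comp (continuous_id.matrix_mul continuous_id.matrix_conjTranspose).matrix_det

lemma minor_cont (f : Fin d → Fin N) : Continuous (fun A : Matrix (Fin d) (Fin N) ℂ => (A.submatrix id f).det) :=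
  (continuous_id.matrix_submatrix _ _).matrix_det

lemma Lb_cont (hN : d ≤ N) (h : Gen A) : ContinuousAt Lb A := by
  have hG := G_pos (h.det hN)
  have hfac : (0:ℝ) < d ! := by exact_mod_cast Nat.factorial_pos d
  unfold Lb
  refine ContinuousAt.mul continuousAt_const (ContinuousAt.add ?_ (tendsto_finsetSum _ ?_))
  · exact ((continuousAt_const.mul G_cont.continuousAt).log (mul_pos hfac hG).ne').abs
  · intro f hf
    have := h f (by simpa using hf)
    exact (((minor_cont f).continuousAt.norm.pow 2).log (pow_ne_zero 2 (norm_ne_zero_iff.2 this))).abs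

lemma Gen_open (h : Gen A) : ∀ᶠ B in 𝓝 A, Gen B := by
  unfold Gen
  rw [Filter.eventually_all]
  intro f
  by_cases hf : Function.Injective f
  · filter_upwards [(minor_cont f).continuousAt.eventually_ne (h f hf)] with B hB _ using hB
  · exact Eventually.of_forall fun B hB => absurd hB hf

lemma Qc_cont (hd : 1 ≤ d) (hN : d < N) (h : Gen A) : ContinuousAt Qc A := by
  have hsc : Continuous (fun B : Matrix (Fin d) (Fin N) ℂ => sc B (Xc A)) :=
    continuous_id.matrix_mul continuous_const
  have hP : Tendsto (fun B => Pr (sc B (Xc A))) (𝓝 A) (𝓝 (Pr (sc A (Xc A)))) :=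
    Pr_cont hsc.continuousAt (sc_det (h.det hN.le) _)
  refine tendsto_of_fro (H := fun B => Pr (sc B (Xc A))) ?_ hP
  have hlim : Tendsto (fun B => 1 / 2 * ∑ i, (Lb B + |Xc A i|) * |(Pr (sc B (Xc A)) i i).re - (d : ℝ) / N|) (𝓝 A) (𝓝 0) := by
    have : (0:ℝ) = 1 / 2 * ∑ i : Fin N, (Lb A + |Xc A i|) * |(Pr (sc A (Xc A)) i i).re - (d : ℝ) / N| := by
      have e : ((d : ℂ) / N).re = (d : ℝ) / N := by
        rw [← Complex.ofReal_natCast, ← Complex.ofReal_natCast, ← Complex.ofReal_div, Complex.ofReal_re]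
      simp [(Xc_spec hd hN h).2.2, e]
    rw [this]
    refine tendsto_const_nhds.mul (tendsto_finsetSum _ fun i _ => ?_)
    refine ((Lb_cont hN.le h).tendsto.add tendsto_const_nhds).mul (Tendsto.abs (Tendsto.sub_const ?_ _))
    exact (Complex.continuous_re.tendsto _).comp (tendsto_pi_nhds.1 (tendsto_pi_nhds.1 hP i) i)
  refine squeeze_zero' (Eventually.of_forall fun B => by unfold fro; positivity) ?_ hlim
  filter_upwards [Gen_open h] with B hB using est hd hN hB _
end

section
variable {N d : ℕ}
open scoped Nat Topology
open Filter Polynomial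

lemma rank_factor (P : Matrix (Fin N) (Fin N) ℂ) (hr : P.rank = d) :
    ∃ (C : Matrix (Fin N) (Fin d) ℂ) (K : Matrix (Fin d) (Fin N) ℂ), P = C * K := by
  let V := LinearMap.range P.mulVecLin
  have hV : Module.finrank ℂ V = d := hr
  let b := Module.finBasisOfFinrankEq ℂ V hV
  refine ⟨Matrix.of fun i k => (b k : Fin N → ℂ) i,
    Matrix.of fun k j => b.repr ⟨P.mulVecLin (Pi.single j 1), LinearMap.mem_range_self _ _⟩ k, ?_⟩
  ext i j
  have key : ∀ v : V, (v : Fin N → ℂ) i = ∑ k, (b k : Fin N → ℂ) i * b.repr v k := by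
    intro v
    have h2 := congrFun (congrArg (fun v : V => (v : Fin N → ℂ)) (b.sum_repr v)) i
    refine h2.symm.trans ?_
    simp only [Submodule.coe_sum, Finset.sum_apply, Submodule.coe_smul, Pi.smul_apply, smul_eq_mul]
    exact Finset.sum_congr rfl fun k _ => mul_comm _ _
  simp only [Matrix.mul_apply, Matrix.of_apply]
  have h3 : P.mulVecLin (Pi.single j 1) i = P i j := by simp
  rw [← h3]
  exact key ⟨P.mulVecLin (Pi.single j 1), LinearMap.mem_range_self _ _⟩

lemma exists_A {P : Matrix (Fin N) (Fin N) ℂ} (h : P ∈ ProjSet N d) :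
    ∃ A : Matrix (Fin d) (Fin N) ℂ, (A * Aᴴ).det ≠ 0 ∧ Pr A = P := by
  obtain ⟨h1, h2, h3, _⟩ := h
  obtain ⟨C, K, hCK⟩ := rank_factor P h3
  set C' := P * C with hC'
  have e1 : P = C' * K := by rw [hC', Matrix.mul_assoc, ← hCK, h2]
  have e2 : P * C' = C' := by rw [hC', ← Matrix.mul_assoc, h2]
  have hr : d ≤ (C'ᴴ).rank := by
    have : P = (C' * K)ᴴ := by rw [← e1, h1]
    rw [Matrix.conjTranspose_mul] at this
    have h4 := Matrix.rank_mul_le_right Kᴴ C'ᴴ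
    rw [← this] at h4; omega
  have hdet := det_ne_of_rank' hr
  refine ⟨C'ᴴ, hdet, ?_⟩
  have f1 : Pr (C'ᴴ) * C' = C' := by
    have := congrArg Matrix.conjTranspose (Pr_mul_self hdet)
    rwa [Matrix.conjTranspose_mul, Pr_conj, Matrix.conjTranspose_conjTranspose] at this
  have f2 : Pr (C'ᴴ) * P = P := by
    conv_lhs => rw [e1]
    rw [← Matrix.mul_assoc, f1, ← e1]
  have f3 : P * Pr (C'ᴴ) = Pr (C'ᴴ) := by
    rw [Pr, Matrix.conjTranspose_conjTranspose, ← Matrix.mul_assoc, ← Matrix.mul_assoc, e2]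
  have f4 := congrArg Matrix.conjTranspose f2
  rw [Matrix.conjTranspose_mul, h1, Pr_conj, f3] at f4
  exact f4

lemma exists_Gen (N d : ℕ) : ∃ B : Matrix (Fin d) (Fin N) ℂ, Gen B := by
  refine ⟨Matrix.of fun k i => ((i : ℕ) : ℂ) ^ (k : ℕ), fun f hf => ?_⟩
  have : (Matrix.of fun (k : Fin d) (i : Fin N) => ((i : ℕ) : ℂ) ^ (k : ℕ)).submatrix id f
      = (Matrix.vandermonde fun j => ((f j : ℕ) : ℂ))ᵀ := by
    ext i j; simp [Matrix.vandermonde]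
  rw [this, Matrix.det_transpose, Matrix.det_vandermonde_ne_zero_iff]
  intro a b hab
  have hab' : ((f a : ℕ) : ℂ) = ((f b : ℕ) : ℂ) := hab
  have : ((f a : ℕ)) = (f b : ℕ) := by exact_mod_cast hab'
  exact hf (Fin.ext this)

/-- the complex line from `A` to `B` -/
def ln (A B : Matrix (Fin d) (Fin N) ℂ) (z : ℂ) : Matrix (Fin d) (Fin N) ℂ := A + z • (B - A)

lemma exists_poly (A B : Matrix (Fin d) (Fin N) ℂ) (f : Fin d → Fin N) :
    ∃ p : ℂ[X], ∀ z, p.eval z = ((ln A B z).submatrix id f).det := by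
  let M : Matrix (Fin d) (Fin d) ℂ[X] := Matrix.of fun i j => C (A i (f j)) + X * C (B i (f j) - A i (f j))
  refine ⟨M.det, fun z => ?_⟩
  rw [← Polynomial.coe_evalRingHom, RingHom.map_det]
  congr 1
  ext i j
  simp [M, ln]

lemma log_poly {p : ℂ[X]} (hp : p ≠ 0) :
    Tendsto (fun t : ℝ => t * |Real.log (‖p.eval (t : ℂ)‖ ^ 2)|) (𝓝[>] 0) (𝓝 0) := by
  obtain ⟨q, hq, hq0⟩ := Polynomial.exists_eq_pow_rootMultiplicity_mul_and_not_dvd p hp 0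
  set k := p.rootMultiplicity 0
  have hq1 : q.eval 0 ≠ 0 := by
    intro h; exact hq0 (Polynomial.dvd_iff_isRoot.2 h)
  have hqc : Continuous (fun t : ℝ => q.eval (t : ℂ)) := q.continuous.comp Complex.continuous_ofReal
  have hqt : Tendsto (fun t : ℝ => Real.log ‖q.eval (t : ℂ)‖) (𝓝[>] 0) (𝓝 (Real.log ‖q.eval 0‖)) := by
    have : ContinuousAt (fun t : ℝ => Real.log ‖q.eval (t : ℂ)‖) 0 :=
      hqc.continuousAt.norm.log (by simpa using hq1)
    have h2 := this.tendsto.mono_left (nhdsWithin_le_nhds (s := Set.Ioi 0))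
    simpa using h2
  have hev : ∀ᶠ t : ℝ in 𝓝[>] 0, q.eval (t : ℂ) ≠ 0 :=
    (hqc.continuousAt.eventually_ne (by simpa using hq1)).filter_mono nhdsWithin_le_nhds
  have hid : Tendsto (fun t : ℝ => t) (𝓝[>] 0) (𝓝 0) := nhdsWithin_le_nhds
  have hlog : Tendsto (fun t : ℝ => Real.log t * t) (𝓝[>] 0) (𝓝 0) := by
    have := tendsto_log_mul_rpow_nhdsGT_zero (r := 1) one_pos
    simpa using this
  have h1 : Tendsto (fun t : ℝ => 2 * k * (Real.log t * t) + 2 * (t * Real.log ‖q.eval (t : ℂ)‖)) (𝓝[>] 0) (𝓝 0) := by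
    have := (hlog.const_mul (2 * (k : ℝ))).add ((hid.mul hqt).const_mul 2)
    simpa using this
  have h2 := h1.abs
  rw [abs_zero] at h2
  refine h2.congr' ?_
  filter_upwards [hev, self_mem_nhdsWithin] with t ht ht0
  have ht0 : 0 < t := ht0
  have e : p.eval (t : ℂ) = (t : ℂ) ^ k * q.eval (t : ℂ) := by
    conv_lhs => rw [hq]
    simp
  rw [e, norm_mul, norm_pow, Complex.norm_real, Real.norm_of_nonneg ht0.le, Real.log_pow,
    Real.log_mul (by positivity) (norm_ne_zero_iff.2 ht), Real.log_pow]
  rw [show t * |((2:ℕ) : ℝ) * ((k : ℝ) * Real.log t + Real.log ‖q.eval (t : ℂ)‖)| = |t * (((2:ℕ) : ℝ) * ((k : ℝ) * Real.log t + Real.log ‖q.eval (t : ℂ)‖))| by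
    rw [abs_mul t, abs_of_pos ht0]]
  congr 1; push_cast; ring

lemma ln_MD (A B : Matrix (Fin d) (Fin N) ℂ) (t : ℝ) : MD (fun s : ℝ => ln A B s) (B - A) t := by
  intro i j
  have h1 : HasDerivAt (fun s : ℝ => (s : ℂ)) 1 t := by simpa using (hasDerivAt_id t).ofReal_comp
  have h2 := (h1.mul_const (B i j - A i j)).const_add (A i j)
  rw [one_mul] at h2
  exact h2

lemma ln_cont (A B : Matrix (Fin d) (Fin N) ℂ) : Continuous (ln A B) := by
  unfold ln; fun_prop

lemma Lb_ln {A B : Matrix (Fin d) (Fin N) ℂ} (hA : (A * Aᴴ).det ≠ 0) (hB : Gen B) :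
    Tendsto (fun t : ℝ => t * Lb (ln A B t)) (𝓝[>] 0) (𝓝 0) := by
  classical
  have hid : Tendsto (fun t : ℝ => t) (𝓝[>] 0) (𝓝 0) := nhdsWithin_le_nhds
  have hfac : (0:ℝ) < d ! := by exact_mod_cast Nat.factorial_pos d
  have h1 : Tendsto (fun t : ℝ => t * |Real.log ((d ! : ℝ) * G (ln A B t))|) (𝓝[>] 0) (𝓝 0) := by
    have hc : ContinuousAt (fun t : ℝ => |Real.log ((d ! : ℝ) * G (ln A B t))|) 0 := by
      have : Continuous (fun t : ℝ => G (ln A B t)) :=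
        G_cont.comp ((ln_cont A B).comp Complex.continuous_ofReal)
      refine ((continuousAt_const.mul this.continuousAt).log ?_).abs
      have := G_pos hA
      have e : ln A B ((0:ℝ) : ℂ) = A := by simp [ln]
      show (d ! : ℝ) * G (ln A B ((0:ℝ) : ℂ)) ≠ 0
      rw [e]; exact (mul_pos hfac this).ne'
    have := hid.mul (hc.tendsto.mono_left (nhdsWithin_le_nhds (s := Set.Ioi 0)))
    rwa [zero_mul] at this
  have h2 : Tendsto (fun t : ℝ => ∑ f : Fin d → Fin N with Function.Injective f,
      t * |Real.log (‖((ln A B t).submatrix id f).det‖ ^ 2)|) (𝓝[>] 0) (𝓝 0) := by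
    have e : (0:ℝ) = ∑ f : Fin d → Fin N with Function.Injective f, 0 := by simp
    conv => arg 3; rw [e]
    refine tendsto_finsetSum _ fun f hf => ?_
    obtain ⟨p, hp⟩ := exists_poly A B f
    have hp0 : p ≠ 0 := by
      rintro rfl
      have h := hp 1
      have := hB f (by simpa using hf)
      simp [ln] at h
      exact this h.symm
    simpa only [hp] using log_poly hp0
  have h3 := (h1.add h2).const_mul (N : ℝ)
  rw [add_zero, mul_zero] at h3
  refine h3.congr fun t => ?_
  rw [← Finset.mul_sum]
  unfold Lb
  ring

lemma end_lim (hd : 1 ≤ d) (hN : d < N) {A B : Matrix (Fin d) (Fin N) ℂ} (hA : (A * Aᴴ).det ≠ 0) (hB : Gen B)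
    (hP : Pr A ∈ ProjSet N d) (hev : ∀ᶠ t : ℝ in 𝓝[>] 0, Gen (ln A B t)) :
    Tendsto (fun t : ℝ => Qc (ln A B t)) (𝓝[>] 0) (𝓝 (Pr A)) := by
  have hl0 : ln A B ((0:ℝ) : ℂ) = A := by simp [ln]
  have hMD := ln_MD A B 0
  have hPMD := (hMD.conj.mul ((hMD.mul hMD.conj).inv (by rw [hl0]; exact hA))).mul hMD
  have hPc := hPMD.continuousAt
  change ContinuousAt (fun t : ℝ => Pr (ln A B t)) 0 at hPc
  have hPt : Tendsto (fun t : ℝ => Pr (ln A B t)) (𝓝[>] 0) (𝓝 (Pr A)) := by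
    have := hPc.tendsto.mono_left (nhdsWithin_le_nhds (s := Set.Ioi 0))
    rwa [hl0] at this
  refine tendsto_of_fro (H := fun t : ℝ => Pr (ln A B t)) ?_ hPt
  have hdiag : ∀ i, (Pr A i i).re = (d : ℝ) / N := by
    intro i
    rw [hP.2.2.2 i, ← Complex.ofReal_natCast, ← Complex.ofReal_natCast, ← Complex.ofReal_div, Complex.ofReal_re]
  have hlim : Tendsto (fun t : ℝ => 1 / 2 * ∑ i : Fin N, (t * Lb (ln A B t)) *
      |t⁻¹ * ((Pr (ln A B t) i i).re - (d : ℝ) / N)|) (𝓝[>] 0) (𝓝 0) := by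
    have hterm : ∀ i : Fin N, Tendsto (fun t : ℝ => (t * Lb (ln A B t)) *
        |t⁻¹ * ((Pr (ln A B t) i i).re - (d : ℝ) / N)|) (𝓝[>] 0) (𝓝 0) := by
      intro i
      have h1 := hPMD i i
      have h2 := (Complex.reCLM.hasFDerivAt.comp_hasDerivAt (0:ℝ) h1)
      have h3 := hasDerivAt_iff_tendsto_slope.1 h2
      have h4 := h3.mono_left (nhdsWithin_mono (0:ℝ) (t := ({0}ᶜ : Set ℝ)) (fun t (ht : 0 < t) => ht.ne'))
      have h5 := (Lb_ln hA hB).mul h4.abs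
      rw [zero_mul] at h5
      refine h5.congr fun t => ?_
      congr 2
      rw [slope_def_field, ← hdiag i, sub_zero, div_eq_inv_mul]
      have e : (Pr A i i).re = (Pr (ln A B ((0:ℝ) : ℂ)) i i).re := by rw [hl0]
      rw [e]
      rfl
    have := (tendsto_finsetSum Finset.univ fun i _ => hterm i).const_mul (1/2 : ℝ)
    simpa using this
  refine squeeze_zero' (Eventually.of_forall fun B => by unfold fro; positivity) ?_ hlim
  filter_upwards [hev, self_mem_nhdsWithin] with t ht ht0
  have ht0 : 0 < t := ht0
  have := est hd hN ht 0
  rw [sc_zero] at this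
  refine this.trans (le_of_eq ?_)
  congr 1
  refine Finset.sum_congr rfl fun i _ => ?_
  rw [abs_mul, abs_of_pos (inv_pos.2 ht0)]
  simp
  field_simp

lemma joined (hd : 1 ≤ d) (hN : d < N) {B : Matrix (Fin d) (Fin N) ℂ} (hB : Gen B)
    {P : Matrix (Fin N) (Fin N) ℂ} (hP : P ∈ ProjSet N d) : JoinedIn (ProjSet N d) P (Qc B) := by
  classical
  obtain ⟨A, hA, rfl⟩ := exists_A hP
  obtain ⟨Z, hZm⟩ : ∃ Z : Set ℂ, ∀ z, z ∈ Z ↔ ¬ Gen (ln A B z) := ⟨{z | ¬ Gen (ln A B z)}, fun z => Iff.rfl⟩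
  have hZn : ∀ z, z ∈ Zᶜ ↔ Gen (ln A B z) := fun z => by rw [Set.mem_compl_iff, hZm, not_not]
  have hZ : Z.Finite := by
    choose p hp using exists_poly A B
    have : Z ⊆ ⋃ f ∈ {f : Fin d → Fin N | Function.Injective f}, ((p f).roots.toFinset : Set ℂ) := by
      intro z hz
      rw [hZm] at hz; simp only [Gen] at hz
      push Not at hz
      obtain ⟨f, hf, hfz⟩ := hz
      have hp0 : p f ≠ 0 := by
        intro h0
        have h := hp f 1
        have := hB f hf
        simp [ln, h0] at h
        exact this h.symm
      simp only [Set.mem_iUnion]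
      refine ⟨f, hf, ?_⟩
      simp [hp0, Polynomial.IsRoot, hp, hfz]
    exact (Set.Finite.biUnion (Set.toFinite _) fun f _ => Finset.finite_toSet _).subset this
  have hZc : IsPathConnected Zᶜ := hZ.countable.isPathConnected_compl_of_one_lt_rank (by
    rw [Complex.rank_real_complex]; norm_num)
  have himg : IsPathConnected ((fun z => Qc (ln A B z)) '' Zᶜ) := by
    refine hZc.image' fun z hz => ContinuousAt.continuousWithinAt ?_
    have hz' : Gen (ln A B z) := (hZn z).1 hz
    exact ContinuousAt.comp (g := Qc) (f := ln A B) (x := z) (Qc_cont hd hN hz') (ln_cont A B).continuousAt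
  have hsub : ((fun z => Qc (ln A B z)) '' Zᶜ) ⊆ ProjSet N d := by
    rintro _ ⟨z, hz, rfl⟩
    exact Qc_mem hd hN ((hZn z).1 hz)
  -- small segment
  obtain ⟨ε, hε, hball⟩ : ∃ ε > 0, ∀ z : ℂ, ‖z‖ < ε → z ≠ 0 → Gen (ln A B z) := by
    have hcl : IsClosed (Z \ {0}) := (hZ.subset Set.sdiff_subset).isClosed
    have : (Z \ {0})ᶜ ∈ 𝓝 (0 : ℂ) := hcl.isOpen_compl.mem_nhds (by simp)
    obtain ⟨ε, hε, h⟩ := Metric.mem_nhds_iff.1 this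
    refine ⟨ε, hε, fun z hz hz0 => ?_⟩
    have := h (show z ∈ Metric.ball 0 ε by simpa using hz)
    by_contra hc
    exact this ⟨(hZm z).2 hc, hz0⟩
  set η := ε / 2 with hη
  have hη0 : 0 < η := by positivity
  have hgen : ∀ t : ℝ, 0 < t → t ≤ η → Gen (ln A B t) := by
    intro t ht0 ht
    apply hball
    · rw [Complex.norm_real, Real.norm_of_nonneg ht0.le]; linarith
    · exact_mod_cast ht0.ne'
  have hlim := end_lim hd hN hA hB hP (by
    filter_upwards [Ioc_mem_nhdsGT hη0] with t ht using hgen t ht.1 ht.2)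
  have hseg : JoinedIn (ProjSet N d) (Pr A) (Qc (ln A B η)) := by
    let γ : ℝ → Matrix (Fin N) (Fin N) ℂ := fun s => if s ≤ 0 then Pr A else Qc (ln A B ((s * η : ℝ) : ℂ))
    refine JoinedIn.ofLine (f := γ) ?_ (by simp [γ]) (by simp [γ]) ?_
    · intro s hs
      by_cases hs0 : s = 0
      · subst hs0
        have h1 : Tendsto (fun s : ℝ => s * η) (𝓝[>] 0) (𝓝[>] 0) := by
          refine tendsto_nhdsWithin_iff.2 ⟨?_, ?_⟩
          · have : Tendsto (fun s : ℝ => s * η) (𝓝 0) (𝓝 (0 * η)) := (continuous_mul_const η).tendsto 0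
            rw [zero_mul] at this
            exact this.mono_left nhdsWithin_le_nhds
          · filter_upwards [self_mem_nhdsWithin] with s hs using mul_pos hs hη0
        have h2 : Tendsto γ (𝓝[>] 0) (𝓝 (Pr A)) := by
          refine (hlim.comp h1).congr' ?_
          filter_upwards [self_mem_nhdsWithin] with s hs
          have hs : 0 < s := hs
          simp [γ, not_le.2 hs]
        have h3 : ContinuousWithinAt γ (Set.Ici 0) 0 := by
          rw [← continuousWithinAt_Ioi_iff_Ici]
          have : γ 0 = Pr A := by simp [γ]
          rw [ContinuousWithinAt, this]; exact h2
        exact h3.mono (fun s hs => hs.1)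
      · have hs1 : 0 < s := lt_of_le_of_ne hs.1 (Ne.symm hs0)
        apply ContinuousAt.continuousWithinAt
        have hg := hgen (s * η) (mul_pos hs1 hη0) (by nlinarith [hs.2])
        have hc : ContinuousAt (fun s : ℝ => Qc (ln A B ((s * η : ℝ) : ℂ))) s := by
          refine ContinuousAt.comp (g := Qc) (f := fun s : ℝ => ln A B ((s * η : ℝ) : ℂ)) (Qc_cont hd hN hg) ?_
          exact ((ln_cont A B).comp (Complex.continuous_ofReal.comp (continuous_mul_const η))).continuousAt
        refine hc.congr ?_
        filter_upwards [lt_mem_nhds hs1] with u hu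
        simp [γ, not_le.2 hu]
    · rintro _ ⟨s, hs, rfl⟩
      by_cases hs0 : s ≤ 0
      · simp only [γ, hs0, if_true]; exact hP
      · simp only [γ, hs0, if_false]
        push Not at hs0
        exact Qc_mem hd hN (hgen (s * η) (mul_pos hs0 hη0) (by nlinarith [hs.2]))
  have hB1 : ln A B 1 = B := by simp [ln]
  have hj : JoinedIn (ProjSet N d) (Qc (ln A B η)) (Qc B) := by
    refine (himg.joinedIn _ ⟨(η : ℂ), ?_, rfl⟩ _ ⟨1, ?_, by simp [hB1]⟩).mono hsub
    · exact (hZn _).2 (hgen η hη0 le_rfl)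
    · exact (hZn _).2 (hB1.symm ▸ hB)
  exact hseg.trans hj
end

/-- `𝓖_{N,d}^ℂ` is path-connected for `N ≥ d ≥ 1`. -/
theorem projSet_complex_pathConnected (N d : ℕ) (hd : 1 ≤ d) (hN : d ≤ N) :
    IsPathConnected (ProjSet N d) := by
  rcases hN.lt_or_eq with hlt | rfl
  · obtain ⟨B, hB⟩ := exists_Gen N d
    exact ⟨Qc B, Qc_mem hd hlt hB, fun _ hy => (joined hd hlt hB hy).symm⟩
  · have : ProjSet d d = {1} := by
      ext P
      simp only [Set.mem_singleton_iff]
      constructor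
      · rintro ⟨_, h2, h3, _⟩
        have hdet := det_ne_of_rank h3
        have h4 := Matrix.nonsing_inv_mul P (isUnit_iff_ne_zero.2 hdet)
        calc P = (P⁻¹ * P) * P := by rw [h4, Matrix.one_mul]
          _ = P⁻¹ * P := by rw [Matrix.mul_assoc, h2]
          _ = 1 := h4
      · rintro rfl
        refine ⟨by simp, by simp, by simp, fun n => ?_⟩
        have : (d : ℂ) ≠ 0 := by exact_mod_cast (by omega : d ≠ 0)
        simp [this]
    rw [this]
    exact isPathConnected_singleton 1
end
end

section
/- For all integers N and d with N ≥ d ≥ 1, the set 𝓕_{N,d}^ℂ is an irreducible real algebraic variety: for any two polynomials p and q with real coefficients in the 2dN real variables given by the real and imaginary parts of the entries of a d×N complex matrix, if every F ∈ 𝓕_{N,d}^ℂ satisfies p(F) = 0 or q(F) = 0, then p vanishes at every point of 𝓕_{N,d}^ℂ, or q vanishes at every point of 𝓕_{N,d}^ℂ. -/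
noncomputable section

/-- The set of finite unit norm tight frames (FUNTFs) of `N` vectors in `𝕜^d`,
viewed as `d × N` matrices `F` with unit-norm columns and `F * Fᴴ = (N/d) • 1`. -/
def FUNTF (𝕜 : Type*) [RCLike 𝕜] (N d : ℕ) : Set (Matrix (Fin d) (Fin N) 𝕜) :=
  {F | F * F.conjTranspose = ((N : 𝕜) / (d : 𝕜)) • 1 ∧
       ∀ n, (F.conjTranspose * F) n n = 1}

/-- Evaluation of a real polynomial in the `2dN` real variables given by the real and
imaginary parts of the entries of a `d × N` complex matrix: the variable `(i, n, true)`
is the real part of the `(i,n)` entry, and `(i, n, false)` is its imaginary part. -/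
def evalRI {d N : ℕ} (p : MvPolynomial (Fin d × Fin N × Bool) ℝ)
    (F : Matrix (Fin d) (Fin N) ℂ) : ℝ :=
  MvPolynomial.eval (fun v => if v.2.2 then (F v.1 v.2.1).re else (F v.1 v.2.1).im) p


open Finset

/-- exponent of a tuple -/
def expo {d N : ℕ} (e : Fin d → Fin N) (s : Fin N → ℝ) : ℝ := ∑ i, s (e i)

/-- multiplicity of an index in a tuple -/
def cnt {d N : ℕ} (e : Fin d → Fin N) (n : Fin N) : ℝ := ∑ i, if e i = n then 1 else 0

/-- partition function -/
def ZZ {d N : ℕ} (c : (Fin d → Fin N) → ℝ) (s : Fin N → ℝ) : ℝ :=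
  ∑ e, c e * Real.exp (expo e s)

/-- gradient of the partition function -/
def MM {d N : ℕ} (c : (Fin d → Fin N) → ℝ) (s : Fin N → ℝ) (n : Fin N) : ℝ :=
  ∑ e, c e * cnt e n * Real.exp (expo e s)

/-- positivity exactly on injective tuples -/
def Good {d N : ℕ} (c : (Fin d → Fin N) → ℝ) : Prop :=
  (∀ e, Function.Injective e → 0 < c e) ∧ (∀ e, ¬ Function.Injective e → c e = 0)

lemma Good.nonneg {d N : ℕ} {c : (Fin d → Fin N) → ℝ} (hc : Good c) (e) : 0 ≤ c e := by
  by_cases he : Function.Injective e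
  · exact (hc.1 e he).le
  · exact (hc.2 e he).ge

lemma expo_eq_cnt {d N : ℕ} (e : Fin d → Fin N) (v : Fin N → ℝ) :
    expo e v = ∑ n, cnt e n * v n := by
  simp only [expo, cnt, Finset.sum_mul]
  rw [Finset.sum_comm]
  simp

lemma sum_cnt {d N : ℕ} (e : Fin d → Fin N) : ∑ n, cnt e n = d := by
  simp only [cnt]
  rw [Finset.sum_comm]
  simp

lemma expo_add {d N : ℕ} (e : Fin d → Fin N) (s v : Fin N → ℝ) :
    expo e (s + v) = expo e s + expo e v := by
  simp [expo, Finset.sum_add_distrib]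

lemma expo_smul {d N : ℕ} (e : Fin d → Fin N) (t : ℝ) (v : Fin N → ℝ) :
    expo e (t • v) = t * expo e v := by
  simp [expo, Finset.mul_sum]

lemma sum_MM {d N : ℕ} (c : (Fin d → Fin N) → ℝ) (s : Fin N → ℝ) :
    ∑ n, MM c s n = d * ZZ c s := by
  simp only [MM, ZZ]
  rw [Finset.sum_comm, Finset.mul_sum]
  refine Finset.sum_congr rfl fun e _ => ?_
  rw [← sum_cnt e, Finset.sum_mul]
  exact Finset.sum_congr rfl fun n _ => by ring

lemma sum_MM_mul {d N : ℕ} (c : (Fin d → Fin N) → ℝ) (s v : Fin N → ℝ) :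
    ∑ n, MM c s n * v n = ∑ e, c e * expo e v * Real.exp (expo e s) := by
  simp only [MM, Finset.sum_mul]
  rw [Finset.sum_comm]
  refine Finset.sum_congr rfl fun e _ => ?_
  rw [expo_eq_cnt e v, Finset.mul_sum, Finset.sum_mul]
  exact Finset.sum_congr rfl fun n _ => by ring

lemma tuple_swap {d N : ℕ} (hd : 1 ≤ d) (hN : d < N) (n m : Fin N) (hnm : n ≠ m) :
    ∃ e e' : Fin d → Fin N, Function.Injective e ∧ Function.Injective e' ∧
      ∀ s : Fin N → ℝ, expo e s - expo e' s = s n - s m := by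
  have h0 : (⟨0, by omega⟩ : Fin N) ≠ ⟨N - 1, by omega⟩ := by
    intro h; simp at h; omega
  obtain ⟨σ, hσ0, hσ1⟩ : ∃ σ : Equiv.Perm (Fin N), σ ⟨0, by omega⟩ = n ∧
      σ ⟨N - 1, by omega⟩ = m := by
    let τ := Equiv.swap (⟨0, by omega⟩ : Fin N) n
    refine ⟨τ.trans (Equiv.swap (τ ⟨N - 1, by omega⟩) m), ?_, ?_⟩
    · have h1 : τ ⟨0, by omega⟩ = n := Equiv.swap_apply_left _ _
      rw [Equiv.trans_apply, h1]
      refine Equiv.swap_apply_of_ne_of_ne ?_ hnm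
      rw [← h1]
      exact fun h => h0 (τ.injective h)
    · simp
  let e : Fin d → Fin N := fun i => σ (Fin.castLE hN.le i)
  have he : Function.Injective e := σ.injective.comp (Fin.castLE_injective _)
  refine ⟨e, fun i => Equiv.swap n m (e i), he, (Equiv.injective _).comp he, fun s => ?_⟩
  have hi0 : e ⟨0, by omega⟩ = n := by simp only [e]; rw [← hσ0]; rfl
  have hm : ∀ i, e i ≠ m := by
    intro i h
    rw [← hσ1] at h
    have := σ.injective h
    simp [Fin.ext_iff] at this
    omega
  unfold expo
  rw [← Finset.sum_sub_distrib, Finset.sum_eq_single ⟨0, by omega⟩]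
  · beta_reduce
    rw [hi0, Equiv.swap_apply_left]
  · intro i _ hi
    beta_reduce
    rw [Equiv.swap_apply_of_ne_of_ne _ (hm i), sub_self]
    rw [← hi0]
    exact fun h => hi (he h)
  · simp

lemma eq_zero_of_expo {d N : ℕ} (hd : 1 ≤ d) (hN : d < N) (v : Fin N → ℝ)
    (hv : ∀ e : Fin d → Fin N, Function.Injective e → expo e v = 0) (hs : ∑ n, v n = 0) :
    v = 0 := by
  have hc : ∀ n m, v n = v m := by
    intro n m
    by_cases h : n = m
    · rw [h]
    obtain ⟨e, e', he, he', H⟩ := tuple_swap hd hN n m h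
    have := H v
    rw [hv e he, hv e' he'] at this
    linarith
  funext n
  have : ∑ m, v m = N * v n := by
    rw [Finset.sum_congr rfl fun m _ => hc m n]; simp
  rw [hs] at this
  have hN0 : (N : ℝ) ≠ 0 := by norm_cast; omega
  simpa [hN0] using this.symm

lemma sol_unique {d N : ℕ} (hd : 1 ≤ d) (hN : d < N) (c : (Fin d → Fin N) → ℝ) (hc : Good c)
    (s s' : Fin N → ℝ) (h1 : ∑ n, s n = 0) (h1' : ∑ n, s' n = 0)
    (h2 : ∀ n, N * MM c s n = d * ZZ c s) (h2' : ∀ n, N * MM c s' n = d * ZZ c s') : s = s' := by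
  have hN0 : (N : ℝ) ≠ 0 := by norm_cast; omega
  have key : ∀ s v : Fin N → ℝ, (∀ n, N * MM c s n = d * ZZ c s) → ∑ n, v n = 0 →
      ∑ e, c e * expo e v * Real.exp (expo e s) = 0 := by
    intro s v h hv
    rw [← sum_MM_mul]
    have : ∀ n, MM c s n = d * ZZ c s / N := fun n => by
      rw [eq_div_iff hN0, mul_comm]; exact h n
    simp only [this]
    rw [← Finset.mul_sum, hv, mul_zero]
  have hv : ∑ n, (s' - s) n = 0 := by simp [h1, h1']
  have e1 := key s _ h2 hv
  have e2 := key s' _ h2' hv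
  have e3 : ∑ e, c e * ((expo e s' - expo e s) * (Real.exp (expo e s') - Real.exp (expo e s))) = 0 := by
    rw [← sub_self (0:ℝ)]
    nth_rw 1 [← e2]
    rw [← e1, ← Finset.sum_sub_distrib]
    refine Finset.sum_congr rfl fun e _ => ?_
    have : expo e s' = expo e s + expo e (s' - s) := by rw [← expo_add]; simp
    have : expo e (s' - s) = expo e s' - expo e s := by linarith
    rw [this]; ring
  have hnn : ∀ x y : ℝ, 0 ≤ (x - y) * (Real.exp x - Real.exp y) := by
    intro x y
    rcases le_total x y with h | h
    · exact mul_nonneg_of_nonpos_of_nonpos (by linarith) (by linarith [Real.exp_le_exp.2 h])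
    · exact mul_nonneg (by linarith) (by linarith [Real.exp_le_exp.2 h])
  rw [Finset.sum_eq_zero_iff_of_nonneg
    (fun e _ => mul_nonneg (hc.nonneg e) (hnn _ _))] at e3
  have : s' - s = 0 := by
    refine eq_zero_of_expo hd hN _ (fun e he => ?_) hv
    have h3 := e3 e (Finset.mem_univ _)
    have h4 : expo e s' = expo e s + expo e (s' - s) := by rw [← expo_add]; simp
    rcases mul_eq_zero.1 h3 with h | h
    · exact absurd h (hc.1 e he).ne'
    · rcases mul_eq_zero.1 h with h | h
      · linarith
      · have := Real.exp_injective (sub_eq_zero.1 h)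
        linarith
  exact (sub_eq_zero.1 this).symm

lemma continuous_ZZ {d N : ℕ} (c : (Fin d → Fin N) → ℝ) : Continuous (ZZ c) := by
  unfold ZZ expo
  fun_prop

lemma sol_exists {d N : ℕ} (hd : 1 ≤ d) (hN : d < N) (c : (Fin d → Fin N) → ℝ) (hc : Good c) :
    ∃ s : Fin N → ℝ, ∑ n, s n = 0 ∧ ∀ n, N * MM c s n = d * ZZ c s := by
  have hN0 : (N : ℝ) ≠ 0 := by norm_cast; omega
  have : NeZero N := ⟨by omega⟩
  -- upper bound of exponents
  obtain ⟨B, hB⟩ : ∃ B : ℝ, ∀ s : Fin N → ℝ, ZZ c s ≤ ZZ c 0 →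
      ∀ e : Fin d → Fin N, Function.Injective e → expo e s ≤ B := by
    obtain ⟨B, hB⟩ := (Set.finite_range (fun e : Fin d → Fin N => Real.log (ZZ c 0 / c e))).bddAbove
    refine ⟨B, fun s hs e he => ?_⟩
    refine le_trans ?_ (hB ⟨e, rfl⟩)
    have h1 : c e * Real.exp (expo e s) ≤ ZZ c s :=
      Finset.single_le_sum (f := fun e => c e * Real.exp (expo e s))
        (fun e _ => mul_nonneg (hc.nonneg e) (Real.exp_pos _).le) (Finset.mem_univ e)
    have h2 : Real.exp (expo e s) ≤ ZZ c 0 / c e := by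
      rw [le_div_iff₀ (hc.1 e he)]; linarith
    calc expo e s = Real.log (Real.exp (expo e s)) := (Real.log_exp _).symm
      _ ≤ _ := Real.log_le_log (Real.exp_pos _) h2
  have hlow : ∀ s : Fin N → ℝ, ∑ n, s n = 0 → ZZ c s ≤ ZZ c 0 →
      ∀ e : Fin d → Fin N, Function.Injective e → -((N : ℝ) * |B|) ≤ expo e s := by
    intro s hs hZ e he
    have h0 : ∑ k : Fin N, expo (fun i => e i + k) s = 0 := by
      unfold expo
      rw [Finset.sum_comm]
      refine Finset.sum_eq_zero fun i _ => ?_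
      rw [← hs]
      exact Equiv.sum_comp (Equiv.addLeft (e i)) s
    have h1 : ∑ k ∈ Finset.univ.erase (0 : Fin N), expo (fun i => e i + k) s ≤
        ∑ k ∈ Finset.univ.erase (0 : Fin N), |B| :=
      Finset.sum_le_sum fun k _ => (hB s hZ _ (fun a b h => he (add_right_cancel h))).trans
        (le_abs_self B)
    have h2 : ∑ k ∈ Finset.univ.erase (0 : Fin N), |B| ≤ ∑ k : Fin N, |B| :=
      Finset.sum_le_sum_of_subset_of_nonneg (Finset.subset_univ _) fun _ _ _ => abs_nonneg _
    rw [← Finset.add_sum_erase _ _ (Finset.mem_univ (0 : Fin N))] at h0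
    simp only [add_zero] at h0
    simp only [Finset.sum_const, Finset.card_univ, Fintype.card_fin, nsmul_eq_mul] at h2
    simp only [Finset.sum_const, nsmul_eq_mul] at h1
    change expo e s + _ = 0 at h0
    linarith
  let K : Set (Fin N → ℝ) := {s | ∑ n, s n = 0 ∧ ZZ c s ≤ ZZ c 0}
  have hKc : IsClosed K := by
    refine IsClosed.inter ?_ ?_
    · exact isClosed_eq (by fun_prop) continuous_const
    · exact isClosed_le (continuous_ZZ c) continuous_const
  have hKb : K ⊆ Metric.closedBall 0 (|B| + N * |B|) := by
    intro s hs
    have hC : 0 ≤ |B| + N * |B| := by positivity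
    have hdiff : ∀ n m, s n - s m ≤ |B| + N * |B| := by
      intro n m
      by_cases h : n = m
      · rw [h, sub_self]; exact hC
      obtain ⟨e, e', he, he', H⟩ := tuple_swap hd hN n m h
      rw [← H s]
      have := hB s hs.2 e he
      have := hlow s hs.1 hs.2 e' he'
      have := le_abs_self B
      linarith
    rw [mem_closedBall_zero_iff, pi_norm_le_iff_of_nonneg hC]
    intro n
    have hsum : ∑ m : Fin N, (s n - s m) = N * s n := by
      rw [Finset.sum_sub_distrib, hs.1]; simp
    have hsum1 : ∑ m : Fin N, (s n - s m) ≤ N * (|B| + N * |B|) := by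
      refine (Finset.sum_le_sum fun m _ => hdiff n m).trans ?_
      simp [mul_add]
    have hsum2 : -(N * (|B| + N * |B|)) ≤ ∑ m : Fin N, (s n - s m) := by
      have : ∑ m : Fin N, (s m - s n) ≤ N * (|B| + N * |B|) := by
        refine (Finset.sum_le_sum fun m _ => hdiff m n).trans ?_
        simp [mul_add]
      have h2 : ∑ m : Fin N, (s m - s n) = - ∑ m : Fin N, (s n - s m) := by
        rw [← Finset.sum_neg_distrib]; simp
      linarith
    have hNp : (0 : ℝ) < N := by positivity
    rw [Real.norm_eq_abs, abs_le]
    constructor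
    · nlinarith
    · nlinarith
  have hK : IsCompact K := (isCompact_closedBall 0 _).of_isClosed_subset hKc hKb
  have h0K : (0 : Fin N → ℝ) ∈ K := ⟨by simp, le_rfl⟩
  obtain ⟨s, hsK, hmin⟩ := hK.exists_isMinOn ⟨0, h0K⟩ (continuous_ZZ c).continuousOn
  refine ⟨s, hsK.1, fun n => ?_⟩
  let v : Fin N → ℝ := fun m => (if m = n then (N : ℝ) else 0) - 1
  have hv : ∑ m, v m = 0 := by simp [v]
  have hmin' : ∀ t : ℝ, ZZ c s ≤ ZZ c (s + t • v) := by
    intro t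
    by_cases h : ZZ c (s + t • v) ≤ ZZ c 0
    · refine hmin ⟨?_, h⟩
      simp [Finset.sum_add_distrib, hsK.1, ← Finset.mul_sum, hv]
    · exact hsK.2.trans (not_le.1 h).le
  have hder : HasDerivAt (fun t : ℝ => ZZ c (s + t • v))
      (∑ e, c e * expo e v * Real.exp (expo e s)) 0 := by
    have : (fun t : ℝ => ZZ c (s + t • v)) =
        fun t => ∑ e, c e * Real.exp (expo e s + t * expo e v) := by
      funext t; simp only [ZZ, expo_add, expo_smul]
    rw [this]
    refine HasDerivAt.fun_sum fun e _ => ?_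
    have h1 : HasDerivAt (fun t : ℝ => expo e s + t * expo e v) (expo e v) 0 := by
      simpa using ((hasDerivAt_id (0:ℝ)).mul_const (expo e v)).const_add (expo e s)
    have := (h1.exp).const_mul (c e)
    rw [zero_mul, add_zero] at this
    refine this.congr_deriv ?_
    ring
  have hz : ∑ e, c e * expo e v * Real.exp (expo e s) = 0 := by
    refine IsLocalMin.hasDerivAt_eq_zero ?_ hder
    refine Filter.Eventually.of_forall fun t => ?_
    simpa using hmin' t
  rw [← sum_MM_mul] at hz
  simp only [v, mul_sub, mul_one, mul_ite, mul_zero, Finset.sum_sub_distrib, Finset.sum_ite_eq',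
    Finset.mem_univ, if_true, sum_MM] at hz
  linarith

open scoped ContDiff Topology

lemma ift_omega {E Y : Type*} [NormedAddCommGroup E] [NormedSpace ℝ E] [CompleteSpace E]
    [NormedAddCommGroup Y] [NormedSpace ℝ Y] [FiniteDimensional ℝ Y]
    (Φ : E × Y → Y) (u : E × Y) (hΦ : ContDiffAt ℝ ω Φ u)
    (hinj : ∀ v : Y, fderiv ℝ Φ u (0, v) = 0 → v = 0) :
    ∃ g : E → Y, ContDiffAt ℝ ω g u.1 ∧ (∀ᶠ x in 𝓝 u.1, Φ (x, g x) = Φ u) ∧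
      ∀ᶠ v in 𝓝 u, Φ v = Φ u ↔ g v.1 = v.2 := by
  have : CompleteSpace Y := FiniteDimensional.complete ℝ Y
  have hinv : (fderiv ℝ Φ u ∘L .inr ℝ E Y).IsInvertible := by
    let L : Y →ₗ[ℝ] Y := (fderiv ℝ Φ u ∘L .inr ℝ E Y : Y →L[ℝ] Y)
    have hL : Function.Injective L := by
      rw [← LinearMap.ker_eq_bot, LinearMap.ker_eq_bot']
      intro v hv
      exact hinj v (by simpa [L] using hv)
    refine ⟨(LinearEquiv.ofInjectiveEndo L hL).toContinuousLinearEquiv, ?_⟩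
    ext v
    rfl
  exact ⟨hΦ.implicitFunction (by simp) hinv, hΦ.contDiffAt_implicitFunction (by simp) hinv,
    hΦ.eventually_apply_implicitFunction (by simp) hinv,
    hΦ.eventually_apply_eq_iff_implicitFunction (by simp) hinv⟩

lemma fderiv_snd_eq {E Y : Type*} [NormedAddCommGroup E] [NormedSpace ℝ E]
    [NormedAddCommGroup Y] [NormedSpace ℝ Y]
    (Φ : E × Y → Y) (u : E × Y) (hΦ : DifferentiableAt ℝ Φ u) (v w : Y)
    (h : HasDerivAt (fun t : ℝ => Φ (u.1, u.2 + t • v)) w 0) :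
    fderiv ℝ Φ u (0, v) = w := by
  have h1 : HasDerivAt (fun t : ℝ => u + t • ((0 : E), v)) ((0 : E), v) 0 := by
    simpa using ((hasDerivAt_id (0:ℝ)).smul_const ((0 : E), v)).const_add u
  have h2 : HasFDerivAt Φ (fderiv ℝ Φ u) (u + (0:ℝ) • ((0 : E), v)) := by
    simpa using hΦ.hasFDerivAt
  have h3 := h2.comp_hasDerivAt (0:ℝ) h1
  refine h3.unique (h.congr_of_eventuallyEq (Filter.Eventually.of_forall fun t => ?_))
  simp only [Function.comp]
  congr 1
  ext <;> simp

lemma sol_analytic {d N : ℕ} (hd : 1 ≤ d) (hN : d < N) (c : ℂ → (Fin d → Fin N) → ℝ) (z₀ : ℂ)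
    (hc : ∀ᶠ z in 𝓝 z₀, Good (c z)) (hca : ∀ e, ContDiff ℝ ω (fun z => c z e))
    (s : ℂ → Fin N → ℝ)
    (hs : ∀ᶠ z in 𝓝 z₀, ∑ n, s z n = 0 ∧ ∀ n, N * MM (c z) (s z) n = d * ZZ (c z) (s z)) :
    ContDiffAt ℝ ω s z₀ := by
  have hN0 : (N : ℝ) ≠ 0 := by norm_cast; omega
  let Φ : ℂ × (Fin N → ℝ) → (Fin N → ℝ) := fun u n =>
    N * MM (c u.1) u.2 n - d * ZZ (c u.1) u.2 + ∑ m, u.2 m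
  have hz : ∀ u, Φ u = 0 → ∑ n, u.2 n = 0 ∧ ∀ n, N * MM (c u.1) u.2 n = d * ZZ (c u.1) u.2 := by
    intro u hu
    have h1 : ∑ n, Φ u n = 0 := by simp [hu]
    have h2 : ∑ m, u.2 m = 0 := by
      simp only [Φ, Finset.sum_add_distrib, Finset.sum_sub_distrib, ← Finset.mul_sum, sum_MM] at h1
      simp at h1
      have h1' : (N : ℝ) * ∑ m, u.2 m = 0 := by linarith
      simpa [hN0] using h1'
    refine ⟨h2, fun n => ?_⟩
    have h3 := congrFun hu n
    simp only [Φ, h2, Pi.zero_apply] at h3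
    linarith
  have hΦ : ContDiff ℝ ω Φ := by
    have hca' : ∀ e, ContDiff ℝ ω (fun u : ℂ × (Fin N → ℝ) => c u.1 e) :=
      fun e => (hca e).comp contDiff_fst
    rw [contDiff_pi]
    intro n
    simp only [Φ, MM, ZZ, expo]
    fun_prop
  obtain ⟨hs0, hc0⟩ := (hs.and hc).self_of_nhds
  have hu0 : Φ (z₀, s z₀) = 0 := by
    funext n
    simp only [Φ, Pi.zero_apply]
    rw [hs0.2 n, hs0.1]; simp
  have hinj : ∀ v, fderiv ℝ Φ (z₀, s z₀) (0, v) = 0 → v = 0 := by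
    intro v hv
    have hD := fderiv_snd_eq Φ (z₀, s z₀) (hΦ.differentiable (by simp) _) v
      (fun n => ∑ e, c z₀ e * (N * cnt e n - d) * expo e v * Real.exp (expo e (s z₀)) + ∑ m, v m)
      (by
        rw [hasDerivAt_pi]
        intro n
        have : (fun t : ℝ => Φ ((z₀, s z₀).1, (z₀, s z₀).2 + t • v) n) = fun t =>
            ∑ e, c z₀ e * (N * cnt e n - d) * Real.exp (expo e (s z₀) + t * expo e v) +
              (∑ m, s z₀ m + t * ∑ m, v m) := by
          funext t
          simp only [Φ, MM, ZZ, expo_add, expo_smul, Finset.mul_sum, ← Finset.sum_sub_distrib]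
          congr 1
          · exact Finset.sum_congr rfl fun e _ => by ring
          · simp [Finset.sum_add_distrib]
        rw [this]
        refine HasDerivAt.add (HasDerivAt.fun_sum fun e _ => ?_) ?_
        · have h1 : HasDerivAt (fun t : ℝ => expo e (s z₀) + t * expo e v) (expo e v) 0 := by
            simpa using ((hasDerivAt_id (0:ℝ)).mul_const (expo e v)).const_add (expo e (s z₀))
          have := (h1.exp).const_mul (c z₀ e * (N * cnt e n - d))
          rw [zero_mul, add_zero] at this
          refine this.congr_deriv ?_
          ring
        · simpa using ((hasDerivAt_id (0:ℝ)).mul_const (∑ m, v m)).const_add (∑ m, s z₀ m))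
    rw [hv] at hD
    have hDn : ∀ n, ∑ e, c z₀ e * (N * cnt e n - d) * expo e v * Real.exp (expo e (s z₀))
        + ∑ m, v m = 0 := fun n => (congrFun hD n).symm
    have hv0 : ∑ m, v m = 0 := by
      have h1 : ∑ n : Fin N, (∑ e, c z₀ e * (N * cnt e n - d) * expo e v * Real.exp (expo e (s z₀))
        + ∑ m, v m) = 0 := Finset.sum_eq_zero fun n _ => hDn n
      rw [Finset.sum_add_distrib, Finset.sum_comm] at h1
      have h2 : ∀ e : Fin d → Fin N,
          ∑ n, c z₀ e * (N * cnt e n - d) * expo e v * Real.exp (expo e (s z₀)) = 0 := by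
        intro e
        rw [← Finset.sum_mul, ← Finset.sum_mul, ← Finset.mul_sum, Finset.sum_sub_distrib,
          ← Finset.mul_sum, sum_cnt]
        simp
      simp only [h2] at h1
      simpa [hN0] using h1
    have h3 : ∑ n : Fin N, (∑ e, c z₀ e * (N * cnt e n - d) * expo e v *
        Real.exp (expo e (s z₀)) + ∑ m, v m) * v n = 0 :=
      Finset.sum_eq_zero fun n _ => by rw [hDn n, zero_mul]
    have h4 : ∑ e, c z₀ e * (expo e v)^2 * Real.exp (expo e (s z₀)) = 0 := by
      simp only [hv0, add_zero, Finset.sum_mul] at h3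
      rw [Finset.sum_comm] at h3
      have h5 : ∀ e : Fin d → Fin N, ∑ n, c z₀ e * (N * cnt e n - d) * expo e v *
          Real.exp (expo e (s z₀)) * v n =
          N * (c z₀ e * (expo e v)^2 * Real.exp (expo e (s z₀))) := by
        intro e
        have h6 : ∑ n, (N * cnt e n - d) * v n = N * expo e v := by
          simp only [sub_mul, Finset.sum_sub_distrib, ← Finset.mul_sum, hv0, mul_zero, sub_zero,
            mul_assoc, ← expo_eq_cnt]
        calc _ = (c z₀ e * expo e v * Real.exp (expo e (s z₀))) * ∑ n, (N * cnt e n - d) * v n := by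
              rw [Finset.mul_sum]; exact Finset.sum_congr rfl fun n _ => by ring
          _ = _ := by rw [h6]; ring
      simp only [h5, ← Finset.mul_sum] at h3
      simpa [hN0] using h3
    rw [Finset.sum_eq_zero_iff_of_nonneg (fun e _ => mul_nonneg (mul_nonneg (hc0.nonneg e)
      (sq_nonneg _)) (Real.exp_pos _).le)] at h4
    refine eq_zero_of_expo hd hN v (fun e he => ?_) hv0
    have := h4 e (Finset.mem_univ _)
    have h7 := (hc0.1 e he).ne'
    have h8 := (Real.exp_pos (expo e (s z₀))).ne'
    simpa [h7, h8] using this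
  obtain ⟨g, hg, hgz, -⟩ := ift_omega Φ (z₀, s z₀) hΦ.contDiffAt hinj
  refine hg.congr_of_eventuallyEq ?_
  filter_upwards [hgz, hc, hs] with z h1 h2 h3
  obtain ⟨h4, h5⟩ := hz _ (h1.trans hu0)
  exact sol_unique hd hN (c z) h2 _ _ h3.1 h4 h3.2 h5

open scoped Matrix Matrix.Norms.L2Operator ComplexOrder MatrixOrder

lemma cauchy_binet_fun {d N : ℕ} (A : Matrix (Fin d) (Fin N) ℂ) (B : Matrix (Fin N) (Fin d) ℂ) :
    (d.factorial : ℂ) * (A * B).det =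
      ∑ e : Fin d → Fin N, (A.submatrix id e).det * (B.submatrix e id).det := by
  have h1 : (A * B).det = ∑ e : Fin d → Fin N, (A.submatrix id e).det * ∏ i, B (e i) i := by
    rw [Matrix.det_apply']
    simp only [Matrix.mul_apply, Finset.prod_univ_sum, Fintype.piFinset_univ, Finset.mul_sum,
      Finset.prod_mul_distrib]
    rw [Finset.sum_comm]
    refine Finset.sum_congr rfl fun e _ => ?_
    rw [Matrix.det_apply', Finset.sum_mul]
    refine Finset.sum_congr rfl fun σ _ => ?_
    simp only [Matrix.submatrix_apply, id]
    ring
  have h2 : ∀ τ : Equiv.Perm (Fin d), (A * B).det =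
      ∑ e : Fin d → Fin N, (A.submatrix id e).det *
        ((Equiv.Perm.sign τ : ℤ) * ∏ i, B (e (τ i)) i) := by
    intro τ
    rw [h1, ← Equiv.sum_comp (Equiv.arrowCongr τ.symm (Equiv.refl (Fin N)))]
    refine Finset.sum_congr rfl fun e _ => ?_
    have : A.submatrix id (Equiv.arrowCongr τ.symm (Equiv.refl (Fin N)) e) =
        (A.submatrix id e).submatrix id τ := by
      ext i j; simp [Equiv.arrowCongr]
    rw [this, Matrix.det_permute']
    simp [Equiv.arrowCongr]
    ring
  have h3 : ∑ τ : Equiv.Perm (Fin d), (A * B).det = (d.factorial : ℂ) * (A * B).det := by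
    simp [Fintype.card_perm]
  rw [← h3, Finset.sum_congr rfl fun τ _ => h2 τ, Finset.sum_comm]
  refine Finset.sum_congr rfl fun e _ => ?_
  rw [← Finset.mul_sum, Matrix.det_apply' (B.submatrix e id)]
  rfl

/-- squared minors -/
def cF {d N : ℕ} (F : Matrix (Fin d) (Fin N) ℂ) (e : Fin d → Fin N) : ℝ :=
  Complex.normSq (F.submatrix id e).det

/-- full spark -/
def FS {d N : ℕ} (F : Matrix (Fin d) (Fin N) ℂ) : Prop :=
  ∀ e : Fin d → Fin N, Function.Injective e → (F.submatrix id e).det ≠ 0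

lemma FS.good {d N : ℕ} {F : Matrix (Fin d) (Fin N) ℂ} (hF : FS F) : Good (cF F) := by
  constructor
  · intro e he
    exact Complex.normSq_pos.2 (hF e he)
  · intro e he
    simp only [Function.Injective, not_forall] at he
    obtain ⟨i, j, h1, h2⟩ := he
    simp only [cF, Complex.normSq_eq_zero]
    exact Matrix.det_zero_of_column_eq h2 (fun k => by simp [h1])

/-- weighted frame operator -/
def SS {d N : ℕ} (F : Matrix (Fin d) (Fin N) ℂ) (w : Fin N → ℝ) : Matrix (Fin d) (Fin d) ℂ :=
  F * Matrix.diagonal (fun n => (w n : ℂ)) * Fᴴ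

lemma SS_apply {d N : ℕ} (F : Matrix (Fin d) (Fin N) ℂ) (w : Fin N → ℝ) (i j : Fin d) :
    SS F w i j = ∑ n, F i n * (w n : ℂ) * star (F j n) := by
  unfold SS
  rw [Matrix.mul_apply]
  simp only [Matrix.mul_diagonal, Matrix.conjTranspose_apply]

lemma det_SS {d N : ℕ} (F : Matrix (Fin d) (Fin N) ℂ) (w : Fin N → ℝ) :
    (d.factorial : ℂ) * (SS F w).det = ((∑ e : Fin d → Fin N, cF F e * ∏ i, w (e i) : ℝ) : ℂ) := by
  unfold SS
  rw [Matrix.mul_assoc, cauchy_binet_fun]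
  push_cast
  refine Finset.sum_congr rfl fun e _ => ?_
  have : ((Matrix.diagonal (fun n => (w n : ℂ)) * Fᴴ).submatrix e id) =
      Matrix.diagonal (fun i => (w (e i) : ℂ)) * (F.submatrix id e)ᴴ := by
    ext i j
    simp [Matrix.diagonal_mul]
  rw [this, Matrix.det_mul, Matrix.det_diagonal, Matrix.det_conjTranspose, cF,
    Complex.normSq_eq_conj_mul_self]
  simp
  ring

lemma prod_exp {d N : ℕ} (e : Fin d → Fin N) (s : Fin N → ℝ) :
    ∏ i, Real.exp (s (e i)) = Real.exp (expo e s) := by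
  rw [expo, Real.exp_sum]

lemma ZZ_pos {d N : ℕ} (hN : d ≤ N) (c : (Fin d → Fin N) → ℝ) (hc : Good c) (s : Fin N → ℝ) :
    0 < ZZ c s := by
  refine Finset.sum_pos' (fun e _ => mul_nonneg (hc.nonneg e) (Real.exp_pos _).le)
    ⟨Fin.castLE hN, Finset.mem_univ _, mul_pos (hc.1 _ (Fin.castLE_injective hN)) (Real.exp_pos _)⟩

lemma det_SS_exp {d N : ℕ} (F : Matrix (Fin d) (Fin N) ℂ) (s : Fin N → ℝ) :
    (d.factorial : ℂ) * (SS F (fun n => Real.exp (s n))).det = (ZZ (cF F) s : ℂ) := by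
  rw [det_SS]
  simp only [prod_exp, ZZ]

lemma posDef_SS {d N : ℕ} (hN : d ≤ N) (F : Matrix (Fin d) (Fin N) ℂ) (hF : FS F)
    (s : Fin N → ℝ) : (SS F (fun n => Real.exp (s n))).PosDef := by
  have h1 : (SS F (fun n => Real.exp (s n))).PosSemidef := by
    unfold SS
    refine Matrix.PosSemidef.mul_mul_conjTranspose_same ?_ F
    refine Matrix.PosSemidef.diagonal fun n => ?_
    exact Complex.zero_le_real.2 (Real.exp_pos (s n)).le
  refine (Matrix.PosSemidef.posDef_iff_isUnit h1).2 ?_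
  rw [Matrix.isUnit_iff_isUnit_det, isUnit_iff_ne_zero]
  intro h
  have := det_SS_exp F s
  rw [h, mul_zero] at this
  exact (ZZ_pos hN _ hF.good s).ne' (by exact_mod_cast this.symm)

lemma SS_diag {d N : ℕ} (hN : d ≤ N) (F : Matrix (Fin d) (Fin N) ℂ) (hF : FS F)
    (s : Fin N → ℝ) (n : Fin N) :
    (Real.exp (s n) : ℂ) * (Fᴴ * (SS F (fun n => Real.exp (s n)))⁻¹ * F) n n =
      ((MM (cF F) s n / ZZ (cF F) s : ℝ) : ℂ) := by
  set S := SS F (fun n => Real.exp (s n)) with hS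
  have hZ := (ZZ_pos hN _ hF.good s).ne'
  have hdS := det_SS_exp F s
  rw [← hS] at hdS
  have hSu : IsUnit S.det := by
    rw [isUnit_iff_ne_zero]; exact (posDef_SS hN F hF s).det_pos.ne'
  -- double the weight of n
  let w : Fin N → ℝ := fun m => Real.exp (s m) * (if m = n then 2 else 1)
  have h1 : SS F w = S + Matrix.replicateCol Unit (fun i => (Real.exp (s n) : ℂ) * F i n) *
      Matrix.replicateRow Unit (fun i => star (F i n)) := by
    ext i j
    rw [Matrix.add_apply, hS, SS_apply, SS_apply, Matrix.mul_apply]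
    simp only [w]
    have : ∀ m, F i m * ((Real.exp (s m) * (if m = n then 2 else 1) : ℝ) : ℂ) * star (F j m) =
        F i m * (Real.exp (s m) : ℂ) * star (F j m) +
          if m = n then F i m * (Real.exp (s m) : ℂ) * star (F j m) else 0 := by
      intro m
      split_ifs
      · push_cast; ring
      · push_cast; ring
    rw [Finset.sum_congr rfl fun m _ => this m, Finset.sum_add_distrib]
    congr 1
    rw [Finset.sum_ite_eq']
    simp only [Finset.mem_univ, if_true, Finset.univ_unique, Finset.sum_singleton,
      Matrix.replicateCol_apply, Matrix.replicateRow_apply]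
    ring
  have h2 : (d.factorial : ℂ) * (SS F w).det =
      ((ZZ (cF F) s + MM (cF F) s n : ℝ) : ℂ) := by
    rw [det_SS]
    congr 1
    simp only [ZZ, MM, ← Finset.sum_add_distrib]
    refine Finset.sum_congr rfl fun e _ => ?_
    simp only [w, Finset.prod_mul_distrib, prod_exp]
    by_cases he : Function.Injective e
    · have : ∏ i, (if e i = n then (2:ℝ) else 1) = 1 + cnt e n := by
        unfold cnt
        by_cases hn : ∃ i, e i = n
        · obtain ⟨i, hi⟩ := hn
          have : ∀ j, e j = n ↔ j = i := fun j => by rw [← hi]; exact he.eq_iff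
          simp only [this]
          simp; norm_num
        · push Not at hn
          simp [hn]
      rw [this]; ring
    · simp [hF.good.2 e he]
  have h3 := Matrix.det_add_replicateCol_mul_replicateRow (ι := Unit) hSu
    (fun i => (Real.exp (s n) : ℂ) * F i n) (fun i => star (F i n))
  rw [← h1] at h3
  have h4 : (Matrix.replicateRow Unit (fun i => star (F i n)) * S⁻¹ *
      Matrix.replicateCol Unit (fun i => (Real.exp (s n) : ℂ) * F i n)) =
      Matrix.of fun _ _ => (Real.exp (s n) : ℂ) * (Fᴴ * S⁻¹ * F) n n := by
    ext i j
    simp only [Matrix.mul_apply, Matrix.replicateRow_apply, Matrix.replicateCol_apply,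
      Matrix.conjTranspose_apply, Finset.mul_sum, Matrix.of_apply]
    exact Finset.sum_congr rfl fun m _ => by ring
  rw [h4, Matrix.det_unique (n := Unit), Matrix.add_apply, Matrix.one_apply_eq,
    Matrix.of_apply] at h3
  rw [h3, ← mul_assoc, hdS] at h2
  have hZ' : (ZZ (cF F) s : ℂ) ≠ 0 := by exact_mod_cast hZ
  push_cast at h2 ⊢
  rw [eq_div_iff hZ']
  push_cast at h2
  linear_combination h2

lemma sqrt_analytic {d : ℕ} (T : ℂ → Matrix (Fin d) (Fin d) ℂ) (z₀ : ℂ)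
    (hT : ContDiffAt ℝ ω T z₀) (hpos : ∀ᶠ z in 𝓝 z₀, (T z).PosDef) :
    ContDiffAt ℝ ω (fun z => CFC.sqrt (T z)) z₀ := by
  let Φ : ℂ × Matrix (Fin d) (Fin d) ℂ → Matrix (Fin d) (Fin d) ℂ := fun u => u.2 * u.2 - T u.1
  have hp0 := hpos.self_of_nhds
  set Q := CFC.sqrt (T z₀) with hQ
  have hQ2 : Q * Q = T z₀ := CFC.sqrt_mul_sqrt_self (T z₀) hp0.posSemidef.nonneg
  have hQpos : Q.PosDef := by
    have h1 : Q.PosSemidef := Matrix.nonneg_iff_posSemidef.1 (CFC.sqrt_nonneg (T z₀))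
    refine (Matrix.PosSemidef.posDef_iff_isUnit h1).2 ?_
    have := hp0.isUnit
    rw [← hQ2] at this
    exact isUnit_of_mul_isUnit_left this
  have hΦ : ContDiffAt ℝ ω Φ (z₀, Q) := by
    have h1 : ContDiffAt ℝ ω (fun u : ℂ × Matrix (Fin d) (Fin d) ℂ => T u.1) (z₀, Q) :=
      ContDiffAt.comp (z₀, Q) (g := T) hT contDiffAt_fst
    exact (contDiffAt_snd.mul contDiffAt_snd).sub h1
  have hinj : ∀ v, fderiv ℝ Φ (z₀, Q) (0, v) = 0 → v = 0 := by
    intro v hv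
    have hD := fderiv_snd_eq Φ (z₀, Q) (hΦ.differentiableAt (by simp)) v (v * Q + Q * v) (by
      have h1 : HasDerivAt (fun t : ℝ => Q + t • v) v 0 := by
        simpa using ((hasDerivAt_id (0:ℝ)).smul_const v).const_add Q
      have := (h1.mul h1).sub_const (T z₀)
      simp only [zero_smul, add_zero] at this
      exact this)
    rw [hv] at hD
    have h2 : (vᴴ * Q * v).trace + (v * Q * vᴴ).trace = 0 := by
      have : (vᴴ * (v * Q + Q * v)).trace = 0 := by rw [← hD]; simp
      rw [Matrix.mul_add, Matrix.trace_add, Matrix.trace_mul_comm vᴴ (v * Q)] at this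
      rw [Matrix.mul_assoc vᴴ, add_comm]
      exact this
    have h3 : (vᴴ * Q * v).PosSemidef := hQpos.posSemidef.conjTranspose_mul_mul_same v
    have h4 : (v * Q * vᴴ).PosSemidef := hQpos.posSemidef.mul_mul_conjTranspose_same v
    have h5 : (vᴴ * Q * v).trace = 0 := by
      have := h3.trace_nonneg
      have h6 := h4.trace_nonneg
      refine le_antisymm ?_ this
      rw [eq_neg_of_add_eq_zero_left h2]
      simpa using h6
    have h7 : vᴴ * Q * v = 0 := h3.trace_eq_zero_iff.1 h5
    ext i j
    have h8 : star (v.col j) ⬝ᵥ (Q *ᵥ (v.col j)) = 0 := by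
      have := congrFun (congrFun h7 j) j
      rw [Matrix.mul_assoc, Matrix.mul_apply] at this
      simpa [dotProduct, Matrix.mulVec, Matrix.mul_apply] using this
    by_contra hne
    have h9 : v.col j ≠ 0 := fun h => hne (congrFun h i)
    exact (hQpos.dotProduct_mulVec_pos h9).ne' h8
  obtain ⟨g, hg, -, hiff⟩ := ift_omega Φ (z₀, Q) hΦ hinj
  refine hg.congr_of_eventuallyEq ?_
  have hcont : Filter.Tendsto (fun z => (z, CFC.sqrt (T z))) (𝓝 z₀) (𝓝 (z₀, Q)) := by
    refine Filter.Tendsto.prodMk_nhds Filter.tendsto_id ?_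
    have h1 : ContinuousWithinAt CFC.sqrt {a : Matrix (Fin d) (Fin d) ℂ | 0 ≤ a} (T z₀) :=
      CFC.continuousOn_sqrt (T z₀) hp0.posSemidef.nonneg
    refine h1.tendsto.comp (tendsto_nhdsWithin_iff.2 ⟨hT.continuousAt, ?_⟩)
    filter_upwards [hpos] with z hz using hz.posSemidef.nonneg
  filter_upwards [hcont.eventually hiff, hpos] with z h1 h2
  refine (h1.1 ?_).symm
  simp only [Φ]
  rw [CFC.sqrt_mul_sqrt_self (T z) h2.posSemidef.nonneg, hQ2, sub_self, sub_self]

/-- defect from being a FUNTF -/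
def defect {d N : ℕ} (F : Matrix (Fin d) (Fin N) ℂ) : ℝ :=
  ∑ i, ∑ j, ‖(F * Fᴴ - ((N : ℂ) / (d : ℂ)) • (1 : Matrix (Fin d) (Fin d) ℂ)) i j‖ +
    ∑ n, ‖(Fᴴ * F) n n - 1‖

lemma continuous_defect {d N : ℕ} : Continuous (defect (d := d) (N := N)) := by
  unfold defect
  refine Continuous.add ?_ ?_
  · refine continuous_finsetSum _ fun i _ => continuous_finsetSum _ fun j _ => ?_
    refine Continuous.norm (Continuous.matrix_elem ?_ i j)
    fun_prop
  · refine continuous_finsetSum _ fun n _ => ?_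
    refine Continuous.norm (Continuous.sub (Continuous.matrix_elem ?_ n n) continuous_const)
    fun_prop

lemma defect_eq_zero {d N : ℕ} {F : Matrix (Fin d) (Fin N) ℂ} (hF : F ∈ FUNTF ℂ N d) :
    defect F = 0 := by
  obtain ⟨h1, h2⟩ := hF
  have h1' : F * Fᴴ = ((N : ℂ) / (d : ℂ)) • (1 : Matrix (Fin d) (Fin d) ℂ) := h1
  have h2' : ∀ n, (Fᴴ * F) n n = 1 := h2
  simp [defect, h1', h2']

/-- the elementary combinatorial estimate -/
lemma comb_estimate {d N : ℕ} (a : Fin d → ℝ) (b : Fin N → ℝ) (m : Fin d → Fin N → ℝ) (ε : ℝ)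
    (hrow : ∀ i, |∑ n, m i n| ≤ ε) (hcol : ∀ n, |∑ i, m i n| ≤ ε)
    (hp : ∀ i n, b n ≤ a i → 0 ≤ m i n) (hm : ∀ i n, a i ≤ b n → m i n ≤ 0) (i : Fin d)
    (n : Fin N) : |m i n| ≤ (d + N) * ε := by
  have key : ∀ θ : ℝ, (∀ i n, 0 ≤ ((if θ ≤ a i then 1 else 0) - (if θ ≤ b n then 1 else 0)) * m i n) ∧
      ∑ i, ∑ n, ((if θ ≤ a i then 1 else 0) - (if θ ≤ b n then 1 else 0)) * m i n ≤ (d + N) * ε := by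
    intro θ
    constructor
    · intro i n
      split_ifs with h1 h2 h2
      · simp
      · have := hp i n (by linarith); simpa using this
      · have := hm i n (by linarith); simpa using this
      · simp
    · have e1 : ∑ i, ∑ n, ((if θ ≤ a i then 1 else 0) - (if θ ≤ b n then 1 else 0)) * m i n =
          ∑ i, (if θ ≤ a i then 1 else 0) * (∑ n, m i n) -
          ∑ n, (if θ ≤ b n then 1 else 0) * (∑ i, m i n) := by
        simp only [Finset.mul_sum, sub_mul, Finset.sum_sub_distrib]
        congr 1
        exact Finset.sum_comm
      rw [e1]
      have e2 : ∑ i, (if θ ≤ a i then (1:ℝ) else 0) * (∑ n, m i n) ≤ ∑ i : Fin d, ε := by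
        refine Finset.sum_le_sum fun i _ => ?_
        have := abs_le.1 (hrow i)
        have := abs_nonneg (∑ n, m i n)
        split_ifs <;> linarith [hrow i]
      have e3 : -∑ n, (if θ ≤ b n then (1:ℝ) else 0) * (∑ i, m i n) ≤ ∑ n : Fin N, ε := by
        rw [← Finset.sum_neg_distrib]
        refine Finset.sum_le_sum fun n _ => ?_
        have := abs_le.1 (hcol n)
        have := abs_nonneg (∑ i, m i n)
        split_ifs <;> linarith [hcol n]
      simp only [Finset.sum_const, Finset.card_univ, Fintype.card_fin, nsmul_eq_mul] at e2 e3
      linarith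
  have single : ∀ θ : ℝ, ((if θ ≤ a i then 1 else 0) - (if θ ≤ b n then 1 else 0)) * m i n
      ≤ (d + N) * ε := by
    intro θ
    refine le_trans ?_ (key θ).2
    refine le_trans ?_ (Finset.single_le_sum (f := fun i => ∑ n, ((if θ ≤ a i then 1 else 0) -
      (if θ ≤ b n then 1 else 0)) * m i n)
      (fun i _ => Finset.sum_nonneg fun n _ => (key θ).1 i n) (Finset.mem_univ i))
    exact Finset.single_le_sum (f := fun n => ((if θ ≤ a i then 1 else 0) -
      (if θ ≤ b n then 1 else 0)) * m i n) (fun n _ => (key θ).1 i n) (Finset.mem_univ n)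
  rcases lt_trichotomy (a i) (b n) with h | h | h
  · have h1 := single (b n)
    rw [if_neg (not_le.2 h), if_pos le_rfl] at h1
    rw [abs_of_nonpos (hm i n h.le)]
    linarith
  · have : m i n = 0 := le_antisymm (hm i n h.le) (hp i n h.ge)
    have hε : 0 ≤ ε := (abs_nonneg _).trans (hrow i)
    rw [this, abs_zero]
    positivity
  · have h1 := single (a i)
    rw [if_neg (not_le.2 h), if_pos le_rfl] at h1
    rw [abs_of_nonneg (hp i n h.le)]
    linarith

lemma retract_close {d N : ℕ} (F : Matrix (Fin d) (Fin N) ℂ) (Q : Matrix (Fin d) (Fin d) ℂ)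
    (hQ : Q.PosSemidef) (δ : Fin N → ℝ) (hδ : ∀ n, 0 < δ n)
    (hG : Q * F * Matrix.diagonal (fun n => (δ n : ℂ)) ∈ FUNTF ℂ N d) (i : Fin d) (n : Fin N) :
    ‖(Q * F * Matrix.diagonal (fun n => (δ n : ℂ))) i n - F i n‖ ≤
      d * Real.sqrt ((d + N) * defect F) := by
  set G := Q * F * Matrix.diagonal (fun n => (δ n : ℂ)) with hGdef
  let U : Matrix (Fin d) (Fin d) ℂ := hQ.1.eigenvectorUnitary
  have hU : U ∈ Matrix.unitaryGroup (Fin d) ℂ := hQ.1.eigenvectorUnitary.2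
  have hUU : U * Uᴴ = 1 := Unitary.mul_star_self_of_mem hU
  have hUU' : Uᴴ * U = 1 := Unitary.star_mul_self_of_mem hU
  let a : Fin d → ℝ := hQ.1.eigenvalues
  have ha : ∀ i, 0 ≤ a i := hQ.eigenvalues_nonneg
  have hspec : Q = U * Matrix.diagonal (fun i => (a i : ℂ)) * Uᴴ := by
    have := hQ.1.spectral_theorem
    rw [Unitary.conjStarAlgAut_apply] at this
    exact this
  let F' := Uᴴ * F
  let G' := Uᴴ * G
  have hF : F = U * F' := by simp only [F']; rw [← Matrix.mul_assoc, hUU, Matrix.one_mul]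
  have hGU : G = U * G' := by simp only [G']; rw [← Matrix.mul_assoc, hUU, Matrix.one_mul]
  have hG' : ∀ i n, G' i n = (a i : ℂ) * F' i n * (δ n : ℂ) := by
    intro i n
    have : G' = Matrix.diagonal (fun i => (a i : ℂ)) * F' * Matrix.diagonal (fun n => (δ n : ℂ)) := by
      simp only [G', F', hGdef]
      rw [hspec]
      simp only [← Matrix.mul_assoc]
      rw [hUU', Matrix.one_mul]
    rw [this, Matrix.mul_diagonal, Matrix.diagonal_mul]
  have hrowF : ∀ i, ((∑ n, ‖F' i n‖^2 : ℝ) : ℂ) = (F' * F'ᴴ) i i := by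
    intro i
    rw [Matrix.mul_apply]
    push_cast
    exact Finset.sum_congr rfl fun n _ => by
      rw [Matrix.conjTranspose_apply]; exact (Complex.mul_conj' _).symm
  have hrowG : ∀ i, ((∑ n, ‖G' i n‖^2 : ℝ) : ℂ) = (G' * G'ᴴ) i i := by
    intro i
    rw [Matrix.mul_apply]
    push_cast
    exact Finset.sum_congr rfl fun n _ => by
      rw [Matrix.conjTranspose_apply]; exact (Complex.mul_conj' _).symm
  have hcolF : ∀ n, ((∑ i, ‖F' i n‖^2 : ℝ) : ℂ) = (F'ᴴ * F') n n := by
    intro i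
    rw [Matrix.mul_apply]
    push_cast
    exact Finset.sum_congr rfl fun n _ => by
      rw [Matrix.conjTranspose_apply]; exact (Complex.conj_mul' _).symm
  have hcolG : ∀ n, ((∑ i, ‖G' i n‖^2 : ℝ) : ℂ) = (G'ᴴ * G') n n := by
    intro i
    rw [Matrix.mul_apply]
    push_cast
    exact Finset.sum_congr rfl fun n _ => by
      rw [Matrix.conjTranspose_apply]; exact (Complex.conj_mul' _).symm
  have hcF : F'ᴴ * F' = Fᴴ * F := by
    simp only [F', Matrix.conjTranspose_mul, Matrix.conjTranspose_conjTranspose]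
    rw [Matrix.mul_assoc, ← Matrix.mul_assoc U, hUU, Matrix.one_mul]
  have hcG : G'ᴴ * G' = Gᴴ * G := by
    simp only [G', Matrix.conjTranspose_mul, Matrix.conjTranspose_conjTranspose]
    rw [Matrix.mul_assoc, ← Matrix.mul_assoc U, hUU, Matrix.one_mul]
  obtain ⟨hG1, hG2⟩ := hG
  have hrG : G' * G'ᴴ = ((N : ℂ) / (d : ℂ)) • (1 : Matrix (Fin d) (Fin d) ℂ) := by
    have : G * Gᴴ = ((N : ℂ) / (d : ℂ)) • (1 : Matrix (Fin d) (Fin d) ℂ) := hG1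
    simp only [G', Matrix.conjTranspose_mul, Matrix.conjTranspose_conjTranspose]
    rw [Matrix.mul_assoc, ← Matrix.mul_assoc G, this]
    simp [hUU']
  set M := F * Fᴴ - ((N : ℂ) / (d : ℂ)) • (1 : Matrix (Fin d) (Fin d) ℂ) with hM
  have hrF : F' * F'ᴴ = Uᴴ * M * U + ((N : ℂ) / (d : ℂ)) • (1 : Matrix (Fin d) (Fin d) ℂ) := by
    simp only [F', Matrix.conjTranspose_mul, Matrix.conjTranspose_conjTranspose, hM]
    rw [Matrix.mul_sub, Matrix.sub_mul]
    simp only [Matrix.mul_smul, Matrix.smul_mul, Matrix.mul_one, hUU', sub_add_cancel,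
      Matrix.mul_assoc]
  have hMsum : ∑ i, ∑ j, ‖M i j‖ ≤ defect F := by
    unfold defect
    exact le_add_of_nonneg_right (Finset.sum_nonneg fun _ _ => norm_nonneg _)
  let m : Fin d → Fin N → ℝ := fun i n => ‖G' i n‖^2 - ‖F' i n‖^2
  have hm : ∀ i n, m i n = ((a i * δ n)^2 - 1) * ‖F' i n‖^2 := by
    intro i n
    simp only [m, hG', norm_mul, Complex.norm_real, Real.norm_eq_abs, abs_of_nonneg (ha i),
      abs_of_pos (hδ n)]
    ring
  have hest := comb_estimate a (fun n => (δ n)⁻¹) m (defect F)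
    (by
      intro i
      have h1 : ((∑ n, m i n : ℝ) : ℂ) = -(Uᴴ * M * U) i i := by
        simp only [m, Finset.sum_sub_distrib]
        rw [Complex.ofReal_sub, hrowG, hrowF, hrG, hrF, Matrix.add_apply]
        ring
      have h2 : |∑ n, m i n| = ‖(Uᴴ * M * U) i i‖ := by
        rw [← norm_neg, ← h1, Complex.norm_real, Real.norm_eq_abs]
      rw [h2]
      refine le_trans ?_ hMsum
      rw [Matrix.mul_apply, Finset.sum_comm]
      refine (norm_sum_le _ _).trans (Finset.sum_le_sum fun k _ => ?_)
      rw [norm_mul, Matrix.mul_apply]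
      have h3 : ‖U k i‖ ≤ 1 := entry_norm_bound_of_unitary hU k i
      refine (mul_le_of_le_one_right (norm_nonneg _) h3).trans ?_
      refine (norm_sum_le _ _).trans (Finset.sum_le_sum fun l _ => ?_)
      rw [norm_mul, Matrix.conjTranspose_apply, norm_star]
      exact mul_le_of_le_one_left (norm_nonneg _) (entry_norm_bound_of_unitary hU l i))
    (by
      intro n
      have h1 : ((∑ i, m i n : ℝ) : ℂ) = -((Fᴴ * F) n n - 1) := by
        have h0 : (Gᴴ * G) n n = 1 := hG2 n
        simp only [m, Finset.sum_sub_distrib]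
        rw [Complex.ofReal_sub, hcolG, hcolF, hcG, hcF, h0]
        ring
      have h2 : |∑ i, m i n| = ‖(Fᴴ * F) n n - 1‖ := by
        rw [← norm_neg, ← h1, Complex.norm_real, Real.norm_eq_abs]
      rw [h2]
      unfold defect
      refine le_trans (Finset.single_le_sum (f := fun n => ‖(Fᴴ * F) n n - 1‖)
        (fun _ _ => norm_nonneg _) (Finset.mem_univ n)) ?_
      exact le_add_of_nonneg_left (Finset.sum_nonneg fun _ _ => Finset.sum_nonneg fun _ _ =>
        norm_nonneg _))
    (by
      intro i n h
      rw [hm]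
      have : 1 ≤ a i * δ n := by
        rw [inv_le_iff_one_le_mul₀ (hδ n)] at h; exact h
      have h2 : 0 ≤ (a i * δ n)^2 - 1 := by nlinarith
      positivity)
    (by
      intro i n h
      rw [hm]
      have h1 : a i * δ n ≤ 1 := (le_div_iff₀ (hδ n)).1 (by rwa [one_div])
      have h0 : 0 ≤ a i * δ n := mul_nonneg (ha i) (hδ n).le
      exact mul_nonpos_of_nonpos_of_nonneg (by nlinarith) (sq_nonneg _))
  have hentry : ∀ i n, ‖G' i n - F' i n‖ ≤ Real.sqrt ((d + N) * defect F) := by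
    intro i n
    refine Real.le_sqrt_of_sq_le (le_trans ?_ (hest i n))
    have h0 : 0 ≤ a i * δ n := mul_nonneg (ha i) (hδ n).le
    have h1 : G' i n - F' i n = ((a i * δ n - 1 : ℝ) : ℂ) * F' i n := by
      rw [hG']; push_cast; ring
    rw [h1, hm, norm_mul, mul_pow, abs_mul, abs_of_nonneg (sq_nonneg ‖F' i n‖),
      Complex.norm_real, Real.norm_eq_abs, sq_abs]
    refine mul_le_mul_of_nonneg_right ?_ (sq_nonneg _)
    rcases le_total 1 (a i * δ n) with h | h
    · rw [abs_of_nonneg (by nlinarith)]; nlinarith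
    · rw [abs_of_nonpos (by nlinarith)]; nlinarith
  have : G i n - F i n = ∑ k, U i k * (G' k n - F' k n) := by
    conv_lhs => rw [hGU, hF]
    rw [Matrix.mul_apply, Matrix.mul_apply, ← Finset.sum_sub_distrib]
    exact Finset.sum_congr rfl fun k _ => by ring
  rw [this]
  refine (norm_sum_le _ _).trans ?_
  refine (Finset.sum_le_sum fun k _ => (?_ : _ ≤ Real.sqrt ((d + N) * defect F))).trans ?_
  · rw [norm_mul]
    exact (mul_le_of_le_one_left (norm_nonneg _) (entry_norm_bound_of_unitary hU i k)).trans
      (hentry k n)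
  · simp

/-- scaling exponents -/
def sol {d N : ℕ} (F : Matrix (Fin d) (Fin N) ℂ) : Fin N → ℝ :=
  open Classical in
  if h : d < N ∧ ∃ s : Fin N → ℝ, ∑ n, s n = 0 ∧ ∀ n, N * MM (cF F) s n = d * ZZ (cF F) s
  then h.2.choose else 0

lemma sol_spec {d N : ℕ} (hd : 1 ≤ d) (hN : d < N) (F : Matrix (Fin d) (Fin N) ℂ) (hF : FS F) :
    ∑ n, sol F n = 0 ∧ ∀ n, N * MM (cF F) (sol F) n = d * ZZ (cF F) (sol F) := by
  have h : d < N ∧ ∃ s : Fin N → ℝ, ∑ n, s n = 0 ∧ ∀ n, N * MM (cF F) s n = d * ZZ (cF F) s :=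
    ⟨hN, sol_exists hd hN _ hF.good⟩
  unfold sol
  rw [dif_pos h]
  exact h.2.choose_spec

lemma sol_of_not_lt {d N : ℕ} (hN : ¬ d < N) (F : Matrix (Fin d) (Fin N) ℂ) : sol F = 0 := by
  unfold sol
  rw [dif_neg (fun h => hN h.1)]

lemma cnt_of_bij {d N : ℕ} (e : Fin d → Fin N) (he : Function.Bijective e) (n : Fin N) :
    cnt e n = 1 := by
  obtain ⟨i, rfl⟩ := he.2 n
  unfold cnt
  simp [he.1.eq_iff]

lemma sol_eq {d N : ℕ} (hd : 1 ≤ d) (hN : d ≤ N) (F : Matrix (Fin d) (Fin N) ℂ) (hF : FS F)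
    (n : Fin N) : N * MM (cF F) (sol F) n = d * ZZ (cF F) (sol F) := by
  rcases hN.lt_or_eq with h | h
  · exact (sol_spec hd h F hF).2 n
  · subst h
    congr 1
    unfold MM ZZ
    refine Finset.sum_congr rfl fun e _ => ?_
    by_cases he : Function.Injective e
    · rw [cnt_of_bij e (Finite.injective_iff_bijective.1 he), mul_one]
    · rw [hF.good.2 e he]; simp

/-- the frame operator to be inverted -/
def TT {d N : ℕ} (F : Matrix (Fin d) (Fin N) ℂ) : Matrix (Fin d) (Fin d) ℂ :=
  ((N : ℝ) / (d : ℝ)) • (SS F (fun n => Real.exp (sol F n)))⁻¹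

/-- the retraction onto unit norm tight frames -/
def RR {d N : ℕ} (F : Matrix (Fin d) (Fin N) ℂ) : Matrix (Fin d) (Fin N) ℂ :=
  CFC.sqrt (TT F) * F * Matrix.diagonal (fun n => ((Real.exp (sol F n / 2) : ℝ) : ℂ))

lemma TT_posDef {d N : ℕ} (hd : 1 ≤ d) (hN : d ≤ N) (F : Matrix (Fin d) (Fin N) ℂ) (hF : FS F) :
    (TT F).PosDef := by
  unfold TT
  have h1 : (0 : ℝ) < (N : ℝ) / (d : ℝ) := by
    have : 0 < d := hd
    have : 0 < N := by omega
    positivity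
  exact (posDef_SS hN F hF (sol F)).inv.smul h1

lemma RR_mem {d N : ℕ} (hd : 1 ≤ d) (hN : d ≤ N) (F : Matrix (Fin d) (Fin N) ℂ) (hF : FS F) :
    RR F ∈ FUNTF ℂ N d := by
  have hT := TT_posDef hd hN F hF
  have hS := posDef_SS hN F hF (sol F)
  have hdiag := SS_diag hN F hF (sol F)
  have hd0 : (d : ℝ) ≠ 0 := by norm_cast; omega
  have hN0 : (N : ℝ) ≠ 0 := by norm_cast; omega
  have hZ := (ZZ_pos hN (cF F) hF.good (sol F)).ne'
  set c : ℝ := (N : ℝ) / (d : ℝ) with hc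
  have hc0 : c ≠ 0 := div_ne_zero hN0 hd0
  have hcc : ((N : ℂ) / (d : ℂ)) = (c : ℂ) := by rw [hc]; push_cast; rfl
  set Q := CFC.sqrt (TT F) with hQ
  set S := SS F (fun n => Real.exp (sol F n)) with hSdef
  have hTS : TT F = c • S⁻¹ := rfl
  have hQ2 : Q * Q = TT F := CFC.sqrt_mul_sqrt_self (TT F) hT.posSemidef.nonneg
  have hQp : Q.PosSemidef := Matrix.nonneg_iff_posSemidef.1 (CFC.sqrt_nonneg (TT F))
  have hQH : Qᴴ = Q := hQp.1
  set D : Matrix (Fin N) (Fin N) ℂ :=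
    Matrix.diagonal (fun n => ((Real.exp (sol F n / 2) : ℝ) : ℂ)) with hD
  have hDH : Dᴴ = D := by
    rw [hD, Matrix.diagonal_conjTranspose]
    congr 1
    ext n
    exact Complex.conj_ofReal _
  have hexp : ∀ n, ((Real.exp (sol F n / 2) : ℝ) : ℂ) * ((Real.exp (sol F n / 2) : ℝ) : ℂ) =
      ((Real.exp (sol F n) : ℝ) : ℂ) := by
    intro n
    rw [← Complex.ofReal_mul, ← Real.exp_add, add_halves]
  have hDD : D * D = Matrix.diagonal (fun n => ((Real.exp (sol F n) : ℝ) : ℂ)) := by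
    rw [hD, Matrix.diagonal_mul_diagonal]
    congr 1
    ext n
    exact hexp n
  have hRR : RR F = Q * F * D := rfl
  have hSunit : IsUnit S.det := (Matrix.isUnit_iff_isUnit_det S).1 hS.isUnit
  constructor
  · change RR F * (RR F)ᴴ = ((N : ℂ) / (d : ℂ)) • (1 : Matrix (Fin d) (Fin d) ℂ)
    have h1 : RR F * (RR F)ᴴ = Q * (S * Q) := by
      rw [hRR, Matrix.conjTranspose_mul, Matrix.conjTranspose_mul, hQH, hDH, hSdef, SS, ← hDD]
      simp only [Matrix.mul_assoc]
    have h2 : (c⁻¹ • (S * Q)) * Q = 1 := by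
      rw [Matrix.smul_mul, Matrix.mul_assoc, hQ2, hTS, Matrix.mul_smul, smul_smul,
        inv_mul_cancel₀ hc0, one_smul, Matrix.mul_nonsing_inv _ hSunit]
    have h3 := mul_eq_one_comm.1 h2
    rw [h1, hcc, ← h3, Matrix.mul_smul, ← Complex.coe_smul, smul_smul]
    rw [Complex.ofReal_inv, mul_inv_cancel₀ (by exact_mod_cast hc0), one_smul]
  · intro n
    change ((RR F)ᴴ * RR F) n n = 1
    have h1 : (RR F)ᴴ * RR F = D * (c • (Fᴴ * S⁻¹ * F)) * D := by
      rw [hRR, Matrix.conjTranspose_mul, Matrix.conjTranspose_mul, hQH, hDH]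
      have : c • (Fᴴ * S⁻¹ * F) = Fᴴ * (Q * Q) * F := by
        rw [hQ2, hTS, Matrix.mul_smul, Matrix.smul_mul]
      rw [this]
      simp only [Matrix.mul_assoc]
    rw [h1, hD, Matrix.mul_diagonal, Matrix.diagonal_mul, Matrix.smul_apply, mul_right_comm, hexp,
      mul_smul_comm, hdiag n, Complex.real_smul, ← Complex.ofReal_mul, ← Complex.ofReal_one]
    congr 1
    have := sol_eq hd hN F hF n
    rw [hc, div_mul_div_comm, this, div_self (mul_ne_zero hd0 hZ)]

lemma RR_close {d N : ℕ} (hd : 1 ≤ d) (hN : d ≤ N) (F : Matrix (Fin d) (Fin N) ℂ) (hF : FS F)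
    (i : Fin d) (n : Fin N) : ‖RR F i n - F i n‖ ≤ d * Real.sqrt ((d + N) * defect F) :=
  retract_close F (CFC.sqrt (TT F)) (Matrix.nonneg_iff_posSemidef.1 (CFC.sqrt_nonneg (TT F)))
    (fun n => Real.exp (sol F n / 2)) (fun n => Real.exp_pos _) (RR_mem hd hN F hF) i n

/-! ### Vandermonde and full spark along lines -/

lemma exists_FS (d N : ℕ) : ∃ V : Matrix (Fin d) (Fin N) ℂ, FS V := by
  refine ⟨Matrix.of fun a n => ((n : ℕ) : ℂ) ^ (a : ℕ), fun e he => ?_⟩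
  have : (Matrix.of fun (a : Fin d) (n : Fin N) => ((n : ℕ) : ℂ) ^ (a : ℕ)).submatrix id e =
      (Matrix.vandermonde fun i => ((e i : ℕ) : ℂ))ᵀ := by
    ext a i
    simp [Matrix.vandermonde]
  rw [this, Matrix.det_transpose, Matrix.det_vandermonde_ne_zero_iff]
  intro i j hij
  have h1 : ((e i : ℕ) : ℂ) = ((e j : ℕ) : ℂ) := hij
  exact he (Fin.ext (by exact_mod_cast h1))

lemma finite_not_FS {d N : ℕ} (A B : Matrix (Fin d) (Fin N) ℂ) (z₀ : ℂ) (h : FS (A + z₀ • B)) :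
    {z : ℂ | ¬ FS (A + z • B)}.Finite := by
  have key : ∀ e : Fin d → Fin N, Function.Injective e →
      {z : ℂ | ((A + z • B).submatrix id e).det = 0}.Finite := by
    intro e he
    let P : Matrix (Fin d) (Fin d) (Polynomial ℂ) :=
      Matrix.of fun i j => Polynomial.C (A i (e j)) + Polynomial.X * Polynomial.C (B i (e j))
    have hP : ∀ z, Polynomial.eval z P.det = ((A + z • B).submatrix id e).det := by
      intro z
      have := RingHom.map_det (Polynomial.evalRingHom z) P
      rw [Polynomial.coe_evalRingHom] at this
      rw [this]
      congr 1
      ext i j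
      simp [P]
      exact mul_comm _ _
    have hne : P.det ≠ 0 := by
      intro h0
      have := hP z₀
      rw [h0, Polynomial.eval_zero] at this
      exact h e he this.symm
    refine (Polynomial.finite_setOfPred_isRoot hne).subset ?_
    intro z hz
    change Polynomial.eval z P.det = 0
    rw [hP]
    exact hz
  refine (Set.finite_iUnion (fun e : {e : Fin d → Fin N // Function.Injective e} =>
    key e.1 e.2)).subset ?_
  intro z hz
  simp only [FS, Set.mem_ofPred_eq, not_forall, not_not] at hz
  obtain ⟨e, he, h0⟩ := hz
  exact Set.mem_iUnion.2 ⟨⟨e, he⟩, h0⟩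

lemma continuous_evalRI {d N : ℕ} (p : MvPolynomial (Fin d × Fin N × Bool) ℝ) :
    Continuous (evalRI p) := by
  unfold evalRI
  simp only [MvPolynomial.eval_eq']
  refine continuous_finsetSum _ fun m _ => continuous_const.mul
    (continuous_finsetProd _ fun v _ => Continuous.pow ?_ _)
  have h1 : Continuous fun F : Matrix (Fin d) (Fin N) ℂ => F v.1 v.2.1 :=
    Continuous.matrix_elem continuous_id _ _
  split_ifs
  · exact Complex.continuous_re.comp h1
  · exact Complex.continuous_im.comp h1

lemma exists_FS_evalRI {d N : ℕ} (hd : 1 ≤ d) (hN : d ≤ N)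
    (p : MvPolynomial (Fin d × Fin N × Bool) ℝ) (A : Matrix (Fin d) (Fin N) ℂ)
    (hA : A ∈ FUNTF ℂ N d) (hp : evalRI p A ≠ 0) : ∃ F, FS F ∧ evalRI p (RR F) ≠ 0 := by
  obtain ⟨V, hV⟩ := exists_FS d N
  have hfin := finite_not_FS A (V - A) 1 (by simpa using hV)
  have hev : ∀ᶠ z in 𝓝[≠] (0 : ℂ), FS (A + z • (V - A)) := by
    have h1 : ∀ᶠ z in 𝓝 (0 : ℂ), z ∉ ({z : ℂ | ¬ FS (A + z • (V - A))} \ {0}) :=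
      (hfin.subset Set.sdiff_subset).isClosed.isOpen_compl.mem_nhds (by simp)
    filter_upwards [h1.filter_mono nhdsWithin_le_nhds, self_mem_nhdsWithin] with z h2 h3
    by_contra h4
    exact h2 ⟨h4, h3⟩
  have hcl : Continuous fun z : ℂ => A + z • (V - A) := by fun_prop
  have hlim : Filter.Tendsto (fun z : ℂ => A + z • (V - A)) (𝓝[≠] (0 : ℂ)) (𝓝 A) := by
    have := (hcl.tendsto 0).mono_left (nhdsWithin_le_nhds (s := {0}ᶜ))
    simpa using this
  have hdef : Filter.Tendsto (fun z : ℂ => (d : ℝ) * Real.sqrt ((d + N) * defect (A + z • (V - A))))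
      (𝓝[≠] (0 : ℂ)) (𝓝 0) := by
    have hc : Continuous fun F : Matrix (Fin d) (Fin N) ℂ =>
        (d : ℝ) * Real.sqrt ((d + N) * defect F) :=
      continuous_const.mul (Real.continuous_sqrt.comp (continuous_const.mul continuous_defect))
    have := (hc.tendsto A).comp hlim
    rw [defect_eq_zero hA, mul_zero, Real.sqrt_zero, mul_zero] at this
    exact this
  have hRR : Filter.Tendsto (fun z : ℂ => RR (A + z • (V - A))) (𝓝[≠] (0 : ℂ)) (𝓝 A) := by
    refine tendsto_pi_nhds.2 fun i => tendsto_pi_nhds.2 fun n => ?_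
    have h1 : Filter.Tendsto (fun z : ℂ => (A + z • (V - A)) i n) (𝓝[≠] (0 : ℂ)) (𝓝 (A i n)) :=
      tendsto_pi_nhds.1 (tendsto_pi_nhds.1 hlim i) n
    have h2 : Filter.Tendsto (fun z : ℂ => RR (A + z • (V - A)) i n - (A + z • (V - A)) i n)
        (𝓝[≠] (0 : ℂ)) (𝓝 0) := by
      refine squeeze_zero_norm' ?_ hdef
      filter_upwards [hev] with z hz using RR_close hd hN _ hz i n
    simpa using h2.add h1
  have hne : ∀ᶠ z in 𝓝[≠] (0 : ℂ), evalRI p (RR (A + z • (V - A))) ≠ 0 :=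
    (((continuous_evalRI p).tendsto A).comp hRR).eventually_ne hp
  obtain ⟨z, h1, h2⟩ := (hev.and hne).exists
  exact ⟨_, h1, h2⟩

/-! ### Analyticity of the retraction along complex lines -/

lemma contDiffAt_of_entries {d : ℕ} (M : ℂ → Matrix (Fin d) (Fin d) ℂ) (z₀ : ℂ)
    (h : ∀ i j, ContDiffAt ℝ ω (fun z => M z i j) z₀) : ContDiffAt ℝ ω M z₀ := by
  have : M = fun z => ∑ i, ∑ j, M z i j • Matrix.single i j (1 : ℂ) := by
    ext1 z
    conv_lhs => rw [Matrix.matrix_eq_sum_single (M z)]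
    simp [Matrix.smul_single]
  rw [this]
  refine ContDiffAt.sum fun i _ => ContDiffAt.sum fun j _ => ?_
  exact (h i j).smul contDiffAt_const

lemma entries_contDiffAt {d : ℕ} (M : ℂ → Matrix (Fin d) (Fin d) ℂ) (z₀ : ℂ)
    (h : ContDiffAt ℝ ω M z₀) (i j : Fin d) : ContDiffAt ℝ ω (fun z => M z i j) z₀ := by
  let L : Matrix (Fin d) (Fin d) ℂ →ₗ[ℝ] ℂ :=
    { toFun := fun M => M i j, map_add' := fun _ _ => rfl, map_smul' := fun _ _ => rfl }
  exact (LinearMap.toContinuousLinearMap L).contDiff.contDiffAt.comp z₀ h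

lemma contDiff_cF {d N : ℕ} (A B : Matrix (Fin d) (Fin N) ℂ) (e : Fin d → Fin N) :
    ContDiff ℝ ω (fun z : ℂ => cF (A + z • B) e) := by
  have h1 : ContDiff ℝ ω (fun z : ℂ => ((A + z • B).submatrix id e).det) := by
    simp only [Matrix.det_apply']
    refine ContDiff.sum fun σ _ => contDiff_const.mul (contDiff_prod fun i _ => ?_)
    exact contDiff_const.add (contDiff_id.mul contDiff_const)
  unfold cF
  simp only [Complex.normSq_apply]
  have h2 := Complex.reCLM.contDiff.comp h1
  have h3 := Complex.imCLM.contDiff.comp h1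
  exact (h2.mul h2).add (h3.mul h3)

lemma isOpen_FS {d N : ℕ} (A B : Matrix (Fin d) (Fin N) ℂ) (z₀ : ℂ) (h : FS (A + z₀ • B)) :
    ∀ᶠ z in 𝓝 z₀, FS (A + z • B) := by
  have := (finite_not_FS A B z₀ h).isClosed.isOpen_compl.mem_nhds (x := z₀) (by simpa using h)
  filter_upwards [this] with z hz
  simpa using hz

lemma sol_contDiffAt {d N : ℕ} (hd : 1 ≤ d) (A B : Matrix (Fin d) (Fin N) ℂ)
    (z₀ : ℂ) (h : FS (A + z₀ • B)) : ContDiffAt ℝ ω (fun z => sol (A + z • B)) z₀ := by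
  by_cases hlt : d < N
  · have hev := isOpen_FS A B z₀ h
    refine sol_analytic hd hlt (fun z => cF (A + z • B)) z₀ ?_ (contDiff_cF A B) _ ?_
    · filter_upwards [hev] with z hz using hz.good
    · filter_upwards [hev] with z hz using sol_spec hd hlt _ hz
  · simp only [sol_of_not_lt hlt]
    exact contDiffAt_const

lemma RR_contDiffAt {d N : ℕ} (hd : 1 ≤ d) (hN : d ≤ N) (A B : Matrix (Fin d) (Fin N) ℂ)
    (z₀ : ℂ) (h : FS (A + z₀ • B)) (i : Fin d) (n : Fin N) :
    ContDiffAt ℝ ω (fun z => RR (A + z • B) i n) z₀ := by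
  have hev := isOpen_FS A B z₀ h
  have hs : ∀ n, ContDiffAt ℝ ω (fun z => sol (A + z • B) n) z₀ :=
    fun n => contDiffAt_pi.1 (sol_contDiffAt hd A B z₀ h) n
  have hofReal : ∀ f : ℂ → ℝ, ContDiffAt ℝ ω f z₀ → ContDiffAt ℝ ω (fun z => (f z : ℂ)) z₀ :=
    fun f hf => Complex.ofRealCLM.contDiff.contDiffAt.comp z₀ hf
  have hent : ∀ i n, ContDiffAt ℝ ω (fun z : ℂ => (A + z • B) i n) z₀ := fun i n =>
    contDiffAt_const.add (contDiffAt_id.mul contDiffAt_const)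
  have hS : ContDiffAt ℝ ω (fun z => SS (A + z • B) (fun n => Real.exp (sol (A + z • B) n))) z₀ := by
    refine contDiffAt_of_entries _ _ fun i j => ?_
    simp only [SS_apply]
    refine ContDiffAt.sum fun k _ => ((hent i k).mul (hofReal _ (hs k).exp)).mul ?_
    exact Complex.conjCLE.contDiff.contDiffAt.comp z₀ (hent j k)
  have hT : ContDiffAt ℝ ω (fun z => TT (A + z • B)) z₀ := by
    unfold TT
    refine ContDiffAt.const_smul ((N : ℝ) / (d : ℝ)) ?_
    simp only [Matrix.nonsing_inv_eq_ringInverse]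
    obtain ⟨u, hu⟩ := (posDef_SS hN _ h (sol (A + z₀ • B))).isUnit
    refine ContDiffAt.comp (g := Ring.inverse) z₀ ?_ hS
    rw [← hu]
    exact contDiffAt_ringInverse ℝ u
  have hQ := sqrt_analytic _ z₀ hT (by
    filter_upwards [hev] with z hz using TT_posDef hd hN _ hz)
  have hQe := entries_contDiffAt _ z₀ hQ
  unfold RR
  simp only [Matrix.mul_diagonal]
  refine ContDiffAt.mul ?_ (hofReal _ ((hs n).div_const 2).exp)
  simp only [Matrix.mul_apply]
  exact ContDiffAt.sum fun k _ => (hQe i k).mul (hent k n)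

lemma evalRI_RR_analyticAt {d N : ℕ} (hd : 1 ≤ d) (hN : d ≤ N)
    (p : MvPolynomial (Fin d × Fin N × Bool) ℝ) (A B : Matrix (Fin d) (Fin N) ℂ)
    (z₀ : ℂ) (h : FS (A + z₀ • B)) :
    AnalyticAt ℝ (fun z => evalRI p (RR (A + z • B))) z₀ := by
  refine ContDiffAt.analyticAt ?_
  unfold evalRI
  simp only [MvPolynomial.eval_eq']
  refine ContDiffAt.sum fun m _ => contDiffAt_const.mul
    (contDiffAt_prod fun v _ => ContDiffAt.pow ?_ _)
  have h1 := RR_contDiffAt hd hN A B z₀ h v.1 v.2.1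
  split_ifs
  · exact Complex.reCLM.contDiff.contDiffAt.comp z₀ h1
  · exact Complex.imCLM.contDiff.contDiffAt.comp z₀ h1

/-- `𝓕_{N,d}^ℂ` is an irreducible real algebraic variety: if every FUNTF is a zero of `p`
or a zero of `q`, then every FUNTF is a zero of `p`, or every FUNTF is a zero of `q`. -/
theorem funtf_complex_irreducible (N d : ℕ) (hd : 1 ≤ d) (hN : d ≤ N)
    (p q : MvPolynomial (Fin d × Fin N × Bool) ℝ)
    (h : ∀ F ∈ FUNTF ℂ N d, evalRI p F = 0 ∨ evalRI q F = 0) :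
    (∀ F ∈ FUNTF ℂ N d, evalRI p F = 0) ∨ (∀ F ∈ FUNTF ℂ N d, evalRI q F = 0) := by
  by_contra hcon
  push Not at hcon
  obtain ⟨⟨A, hA, hpA⟩, ⟨B, hB, hqB⟩⟩ := hcon
  obtain ⟨F, hF, hpF⟩ := exists_FS_evalRI hd hN p A hA hpA
  obtain ⟨G, hG, hqG⟩ := exists_FS_evalRI hd hN q B hB hqB
  have h0 : FS (F + (0 : ℂ) • (G - F)) := by simpa using hF
  have h1 : FS (F + (1 : ℂ) • (G - F)) := by simpa using hG
  have hfin := finite_not_FS F (G - F) 0 h0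
  have hconn : IsPreconnected {z : ℂ | ¬ FS (F + z • (G - F))}ᶜ :=
    (hfin.countable.isPathConnected_compl_of_one_lt_rank
      (by rw [Complex.rank_real_complex]; norm_num)).isConnected.isPreconnected
  have hmem : ∀ z, z ∈ {z : ℂ | ¬ FS (F + z • (G - F))}ᶜ ↔ FS (F + z • (G - F)) := by
    intro z; simp
  have hq : AnalyticOnNhd ℝ (fun z => evalRI q (RR (F + z • (G - F))))
      {z : ℂ | ¬ FS (F + z • (G - F))}ᶜ :=
    fun z hz => evalRI_RR_analyticAt hd hN q F (G - F) z ((hmem z).1 hz)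
  have hp := (evalRI_RR_analyticAt hd hN p F (G - F) 0 h0).continuousAt.eventually_ne
    (y := 0) (by simpa using hpF)
  have hz := hq.eqOn_zero_of_preconnected_of_eventuallyEq_zero hconn ((hmem 0).2 h0) (by
    filter_upwards [hp, isOpen_FS F (G - F) 0 h0] with z hz1 hz2
    exact (h _ (RR_mem hd hN _ hz2)).resolve_left hz1)
  have := hz ((hmem 1).2 h1)
  simp only [one_smul, add_sub_cancel, Pi.zero_apply] at this
  exact hqG this
end
end
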